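/- arXiv:2603.22240 — 3 statements merged into one kernel-verified Lean document; each statement's English description precedes it below -/
import Mathlib

section
/- Let G be a finite simple graph, d ≥ 1 and k integers, and M ⊆ V(G) a set such that G − M is a caterpillar forest. Let P be a connected merged subgraph of G − M (with respect to the solution-tight packing of G − M), let γ be the essence of P relative to d, let P' be an arbitrary caterpillar with essence γ whose solution-tight packing contains all of its vertices, and let G' be obtained from G by replacing P with P'. If G has a d-coc set of size at most k, then G' has a d-coc set of size at most k' = k − opt(P) + opt(P'). -/
namespace CocPaper

open SimpleGraph

variable {V : Type} {W : Type}

/-- `S` is a `d`-coc set of the subgraph of `G` induced on the vertex set `A`: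
after deleting `S`, every connected component has at most `d` vertices. -/
def IsCocSetOn (G : SimpleGraph V) (A : Set V) (d : ℕ) (S : Set V) : Prop :=
  ∀ c : (G.induce (A \ S)).ConnectedComponent, c.supp.ncard ≤ d

/-- The minimum size of a `d`-coc set of the subgraph of `G` induced on `A`. -/
noncomputable def cocOptOn (G : SimpleGraph V) (A : Set V) (d : ℕ) : ℕ :=
  sInf {m : ℕ | ∃ S : Set V, S ⊆ A ∧ IsCocSetOn G A d S ∧ S.ncard = m}

/-- `S` is a minimum `d`-coc set of the subgraph of `G` induced on `A`. -/
def IsMinCocSetOn (G : SimpleGraph V) (A : Set V) (d : ℕ) (S : Set V) : Prop :=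
  S ⊆ A ∧ IsCocSetOn G A d S ∧ S.ncard = cocOptOn G A d

/-- `X` is a `d`-blocking set of `G[A]`: no minimum `d`-coc set contains `X`. -/
def IsBlockingSetOn (G : SimpleGraph V) (A : Set V) (d : ℕ) (X : Set V) : Prop :=
  ∀ S : Set V, IsMinCocSetOn G A d S → ¬ X ⊆ S

/-- A minimal `d`-blocking set: a `d`-blocking set no proper subset of which is one. -/
def IsMinimalBlockingSetOn (G : SimpleGraph V) (A : Set V) (d : ℕ) (X : Set V) : Prop :=
  IsBlockingSetOn G A d X ∧ ∀ Y : Set V, Y ⊂ X → ¬ IsBlockingSetOn G A d Y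

/-- `G` is (isomorphic to) a path graph, possibly empty. -/
def IsPathGraph (G : SimpleGraph V) : Prop :=
  ∃ n : ℕ, Nonempty (G ≃g SimpleGraph.pathGraph n)

/-- A caterpillar: a tree such that deleting all vertices of degree one yields a
(possibly empty) path. -/
def IsCaterpillar (G : SimpleGraph V) : Prop :=
  G.IsTree ∧ IsPathGraph (G.induce {v : V | (G.neighborSet v).ncard ≠ 1})

/-- A caterpillar forest: every connected component is a caterpillar. -/
def IsCaterpillarForest (G : SimpleGraph V) : Prop :=
  ∀ c : G.ConnectedComponent, IsCaterpillar (G.induce c.supp)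

/-- `G` is (isomorphic to) a cycle graph. -/
def IsCycleGraph (G : SimpleGraph V) : Prop :=
  ∃ n : ℕ, 3 ≤ n ∧ Nonempty (G ≃g SimpleGraph.cycleGraph n)

/-- A connected subgraph of `G` which is a caterpillar, equipped with a fixed
nonempty spine listed in left-to-right order: the spine is a path in `G` inside
`verts`, and every vertex of `verts` off the spine has degree one in the subgraph. -/
structure SubCaterpillar (G : SimpleGraph V) where
  verts : Set V
  n : ℕ
  npos : 0 < n
  spine : Fin n → V
  spineMem : ∀ i, spine i ∈ verts
  spineInj : Function.Injective spine
  spineAdj : ∀ (i : ℕ) (h : i + 1 < n),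
    G.Adj (spine ⟨i, Nat.lt_of_succ_lt h⟩) (spine ⟨i + 1, h⟩)
  isTree : (G.induce verts).IsTree
  pendant : ∀ v ∈ verts, v ∉ Set.range spine → {w : V | w ∈ verts ∧ G.Adj v w}.ncard = 1

/-- The spine position of a vertex of the caterpillar: its spine index if it is a
spine vertex, and the spine index of its parent if it is a pendant. -/
noncomputable def SubCaterpillar.pos {G : SimpleGraph V} (C : SubCaterpillar G) (v : V) : ℕ :=
  sInf {i : ℕ | ∃ h : i < C.n,
    C.spine ⟨i, h⟩ = v ∨ (v ∉ Set.range C.spine ∧ G.Adj v (C.spine ⟨i, h⟩))}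

/-- `P` is a solution-tight packing of the spined caterpillar `C` with respect to `d`.
Packed (induced, connected) subgraphs are represented by their vertex sets. -/
def IsSTP (G : SimpleGraph V) (d : ℕ) (C : SubCaterpillar G) (P : Finset (Set V)) : Prop :=
  (∀ A ∈ P, A ⊆ C.verts ∧ d + 1 ≤ A.ncard ∧ (G.induce A).Connected) ∧
  ((↑P : Set (Set V)).Pairwise fun A B => Disjoint A B) ∧
  P.card = cocOptOn G C.verts d ∧
  (∀ A ∈ P, ∀ v ∈ C.verts, v ∉ Set.range C.spine → ∀ w ∈ A, G.Adj v w → v ∈ A) ∧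
  (∃ i : ℕ, i ≤ C.n ∧ ∀ j : Fin C.n, ((j : ℕ) < i ↔ ∃ A ∈ P, C.spine j ∈ A)) ∧
  (∀ A ∈ P, ∀ j : Fin C.n, C.spine j ∈ A →
    (∀ j' : Fin C.n, C.spine j' ∈ A → (j' : ℕ) ≤ (j : ℕ)) →
    IsCocSetOn G A d {C.spine j})

/-- A caterpillar forest on the vertex set `F` inside the ambient graph `G`,
with a fixed spine and spine order for each connected component. -/
structure SpinedCatForest (G : SimpleGraph V) (F : Set V) where
  numComps : ℕ
  comp : Fin numComps → SubCaterpillar G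
  sub : ∀ c, (comp c).verts ⊆ F
  cover : ∀ v ∈ F, ∃ c, v ∈ (comp c).verts
  disj : ∀ c c', c ≠ c' → Disjoint (comp c).verts (comp c').verts
  noCross : ∀ c c', c ≠ c' → ∀ v ∈ (comp c).verts, ∀ w ∈ (comp c').verts, ¬ G.Adj v w

/-- `P` is a solution-tight packing of the caterpillar forest `𝔉`: the union over the
connected components of solution-tight packings of the components. -/
def IsForestSTP (G : SimpleGraph V) (d : ℕ) {F : Set V} (𝔉 : SpinedCatForest G F)
    (P : Finset (Set V)) : Prop :=
  ∃ Q : Fin 𝔉.numComps → Finset (Set V),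
    (∀ c, IsSTP G d (𝔉.comp c) (Q c)) ∧
    (↑P : Set (Set V)) = ⋃ c, (↑(Q c) : Set (Set V))

/-- Attach `x` new pendant vertices to the vertex `v` of `H`. -/
def attachPendants (H : SimpleGraph W) (v : W) (x : ℕ) : SimpleGraph (W ⊕ Fin x) :=
  SimpleGraph.fromRel fun a b =>
    (∃ u u', a = Sum.inl u ∧ b = Sum.inl u' ∧ H.Adj u u') ∨
    (∃ i : Fin x, a = Sum.inl v ∧ b = Sum.inr i)

/-- The number of vertices of the connected component of `v` in the graph obtained
from `G[A]` by deleting `S` (this is `0` when `v ∈ S` or `v ∉ A`). -/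
noncomputable def compSizeOn (G : SimpleGraph V) (A S : Set V) (v : V) : ℕ :=
  {w : V | ∃ (hv : v ∈ A \ S) (hw : w ∈ A \ S),
    (G.induce (A \ S)).Reachable ⟨v, hv⟩ ⟨w, hw⟩}.ncard

/-- The essence of a spined caterpillar `C` relative to `d`. -/
noncomputable def SubCaterpillar.essence {G : SimpleGraph V} (C : SubCaterpillar G)
    (d : ℕ) : ℕ → ℕ := fun x =>
  let Cx : SimpleGraph (↥C.verts ⊕ Fin x) :=
    attachPendants (G.induce C.verts) ⟨C.spine ⟨0, C.npos⟩, C.spineMem ⟨0, C.npos⟩⟩ x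
  let vlast : ↥C.verts ⊕ Fin x :=
    Sum.inl ⟨C.spine ⟨C.n - 1, Nat.sub_lt C.npos Nat.one_pos⟩,
      C.spineMem ⟨C.n - 1, Nat.sub_lt C.npos Nat.one_pos⟩⟩
  if x ≤ d ∧ cocOptOn Cx Set.univ d = cocOptOn G C.verts d then
    sInf {b : ℕ | ∃ Y : Set (↥C.verts ⊕ Fin x),
      IsMinCocSetOn Cx Set.univ d Y ∧ b = compSizeOn Cx Set.univ Y vlast}
  else d + 1

/-- The set of vertices of `A` adjacent (in `G`) to some vertex of `X`. -/
def nbrIn (G : SimpleGraph V) (A X : Set V) : Set V :=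
  {v : V | v ∈ A ∧ ∃ m ∈ X, G.Adj v m}

/-- The chunk `X` imposes a (strictly positive) conflict on the subgraph of `G`
induced on the vertex set `A`. -/
def HasConflict (G : SimpleGraph V) (d : ℕ) (A X : Set V) : Prop :=
  cocOptOn G A d < (nbrIn G A X).ncard + cocOptOn G (A \ nbrIn G A X) d

/-- A chunk: a subset of the modulator `M` of size one or two. -/
def IsChunk (M X : Set V) : Prop := X ⊆ M ∧ 1 ≤ X.ncard ∧ X.ncard ≤ 2

/-- The `i`-th graph (0-based) of the `α`-merged packing of the ordered packing `H`. -/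
def mergedPiece {t : ℕ} (H : Fin t → Set V) (α i : ℕ) : Set V :=
  ⋃ (j : Fin t) (_ : i * α ≤ (j : ℕ) ∧ (j : ℕ) < i * α + α), H j

/-- `H` enumerates a solution-tight packing of `C` in left-to-right spine order. -/
def IsOrderedSTP (G : SimpleGraph V) (d : ℕ) (C : SubCaterpillar G) {t : ℕ}
    (H : Fin t → Set V) : Prop :=
  Function.Injective H ∧
  (∃ P : Finset (Set V), IsSTP G d C P ∧ (↑P : Set (Set V)) = Set.range H) ∧
  ∀ k k' : Fin t, k < k' → ∀ v ∈ H k, ∀ w ∈ H k', C.pos v < C.pos w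

/-- Composition of a list of functions: `compList [g₁, …, gₗ] = g₁ ∘ g₂ ∘ ⋯ ∘ gₗ`. -/
def compList (L : List (ℕ → ℕ)) : ℕ → ℕ := L.foldr (· ∘ ·) id

/-- `inc^d_i`: maps `i` to `i+1` and fixes all other inputs. -/
def incAt (i : ℕ) : ℕ → ℕ := fun x => if x = i then i + 1 else x

/-- `dec^d_i`: maps `i` to `i-1` and fixes all other inputs. -/
def decAt (i : ℕ) : ℕ → ℕ := fun x => if x = i then i - 1 else x

/-- `inc^d`: maps every `x` with `1 ≤ x ≤ d` to `x+1` and fixes all other inputs. -/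
def incUpTo (d : ℕ) : ℕ → ℕ := fun x => if 1 ≤ x ∧ x ≤ d then x + 1 else x

/-- `inc^d_{i,j}`: maps every `x` with `i ≤ x ≤ j` to `j` and fixes all other inputs. -/
def incIJ (i j : ℕ) : ℕ → ℕ := fun x => if i ≤ x ∧ x ≤ j then j else x

/-- `dec^d_{i,j}`: maps every `x` with `i ≤ x ≤ j` to `i` and fixes all other inputs. -/
def decIJ (i j : ℕ) : ℕ → ℕ := fun x => if i ≤ x ∧ x ≤ j then i else x

/-- The basic functions relative to `d`. -/
def IsBasicFun (d : ℕ) (f : ℕ → ℕ) : Prop :=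
  f = id ∨ (∃ i, 1 ≤ i ∧ i ≤ d ∧ f = decAt i) ∨ f = incUpTo d

/-- The advanced functions relative to `d`. -/
def IsAdvancedFun (d : ℕ) (f : ℕ → ℕ) : Prop :=
  (∃ i, 1 ≤ i ∧ i ≤ d ∧ f = incAt i) ∨
  (∃ i j, 1 ≤ i ∧ i < j ∧ j ≤ d + 1 ∧ f = incIJ i j) ∨
  (∃ i j, i < j ∧ j ≤ d ∧ f = decIJ i j)

/-- The number of fixed points of `f` on the domain `{0, …, d+1}`. -/
def fixCount (d : ℕ) (f : ℕ → ℕ) : ℕ :=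
  ((Finset.range (d + 2)).filter fun x => f x = x).card

/-- The disjoint union of `G₁` and `G₂` together with the edge `a b`. -/
def joinGraph {V₁ V₂ : Type} (G₁ : SimpleGraph V₁) (G₂ : SimpleGraph V₂)
    (a : V₁) (b : V₂) : SimpleGraph (V₁ ⊕ V₂) :=
  SimpleGraph.fromRel fun x y =>
    (∃ u w, x = Sum.inl u ∧ y = Sum.inl w ∧ G₁.Adj u w) ∨
    (∃ u w, x = Sum.inr u ∧ y = Sum.inr w ∧ G₂.Adj u w) ∨
    (x = Sum.inl a ∧ y = Sum.inr b)

/-! ### Components of induced subgraphs -/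

/-- The vertex set of the component of `v` in `G[B]` (empty if `v ∉ B`). -/
def compOf (G : SimpleGraph V) (B : Set V) (v : V) : Set V :=
  {w : V | ∃ (hv : v ∈ B) (hw : w ∈ B), (G.induce B).Reachable ⟨v, hv⟩ ⟨w, hw⟩}

lemma mem_of_reachable_of_closed {G : SimpleGraph V} {K : Set V}
    (hK : ∀ a b, G.Adj a b → a ∈ K → b ∈ K) {u v : V} (h : G.Reachable u v) (hu : u ∈ K) :
    v ∈ K := by
  obtain ⟨p⟩ := h
  induction p with
  | nil => exact hu
  | cons hadj _ ih => exact ih (hK _ _ hadj hu)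

lemma compOf_subset (G : SimpleGraph V) (B : Set V) (v : V) : compOf G B v ⊆ B := by
  rintro w ⟨_, hw, _⟩
  exact hw

lemma mem_compOf_self {G : SimpleGraph V} {B : Set V} {v : V} (h : v ∈ B) :
    v ∈ compOf G B v := ⟨h, h, .rfl⟩

lemma mem_compOf_of_adj {G : SimpleGraph V} {B : Set V} {v a b : V} (ha : a ∈ compOf G B v)
    (hab : G.Adj a b) (hb : b ∈ B) : b ∈ compOf G B v := by
  obtain ⟨hv, ha, h⟩ := ha
  exact ⟨hv, hb, h.trans (SimpleGraph.Adj.reachable (by simpa using hab))⟩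

lemma compOf_subset_of_closed {G : SimpleGraph V} {B K : Set V} {v : V} (hv : v ∈ B → v ∈ K)
    (hK : ∀ a ∈ B, ∀ b ∈ B, G.Adj a b → a ∈ K → b ∈ K) : compOf G B v ⊆ K := by
  rintro w ⟨hvB, hw, h⟩
  exact mem_of_reachable_of_closed (K := {x : B | (x : V) ∈ K})
    (fun a b hab ha => hK a a.2 b b.2 hab ha) h (hv hvB)

lemma mem_compOf_symm {G : SimpleGraph V} {B : Set V} {v w : V} (h : w ∈ compOf G B v) :
    v ∈ compOf G B w := by
  obtain ⟨hv, hw, h⟩ := h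
  exact ⟨hw, hv, h.symm⟩

lemma compOf_eq_of_mem {G : SimpleGraph V} {B : Set V} {v w : V} (h : w ∈ compOf G B v) :
    compOf G B w = compOf G B v := by
  ext z
  obtain ⟨hv, hw, h⟩ := h
  exact ⟨fun ⟨_, hz, h'⟩ => ⟨hv, hz, h.trans h'⟩, fun ⟨_, hz, h'⟩ => ⟨hw, hz, h.symm.trans h'⟩⟩

lemma compOf_eq_empty {G : SimpleGraph V} {B : Set V} {v : V} (h : v ∉ B) :
    compOf G B v = ∅ := by
  ext w
  simp [compOf, h]

lemma compOf_eq_of_inter_nonempty {G : SimpleGraph V} {B : Set V} {v w : V}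
    (h : (compOf G B v ∩ compOf G B w).Nonempty) : compOf G B v = compOf G B w := by
  obtain ⟨z, hv, hw⟩ := h
  rw [← compOf_eq_of_mem hv, compOf_eq_of_mem hw]

lemma compOf_mono {G : SimpleGraph V} {B B' : Set V} (h : B ⊆ B') (v : V) :
    compOf G B v ⊆ compOf G B' v :=
  compOf_subset_of_closed (fun hv => mem_compOf_self (h hv))
    fun _ _ _ hb hab ha => mem_compOf_of_adj ha hab (h hb)

lemma isCocSetOn_iff (G : SimpleGraph V) (A : Set V) (d : ℕ) (S : Set V) :
    IsCocSetOn G A d S ↔ ∀ v ∈ A \ S, (compOf G (A \ S) v).ncard ≤ d := by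
  have key : ∀ v (hv : v ∈ A \ S), (compOf G (A \ S) v).ncard =
      ((G.induce (A \ S)).connectedComponentMk ⟨v, hv⟩).supp.ncard := by
    intro v hv
    rw [← Set.ncard_image_of_injective _ Subtype.val_injective]
    congr 1
    ext w
    constructor
    · rintro ⟨_, hw, h⟩
      exact ⟨⟨w, hw⟩, by simpa using h.symm, rfl⟩
    · rintro ⟨⟨w', hw'⟩, h, rfl⟩
      exact ⟨hv, hw', (by simpa using h : (G.induce (A \ S)).Reachable _ _).symm⟩
  constructor
  · intro h v hv
    rw [key v hv]
    exact h _
  · intro h c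
    induction c using SimpleGraph.ConnectedComponent.ind with
    | _ v => rw [← key v v.2]; exact h v v.2

lemma IsCocSetOn.ncard_compOf_le {G : SimpleGraph V} {A : Set V} {d : ℕ} {S : Set V}
    (h : IsCocSetOn G A d S) (v : V) : (compOf G (A \ S) v).ncard ≤ d := by
  by_cases hv : v ∈ A \ S
  · exact (isCocSetOn_iff G A d S).1 h v hv
  · simp [compOf_eq_empty hv]

lemma compOf_eq_of_preconnected {G : SimpleGraph V} {X : Set V}
    (h : (G.induce X).Preconnected) {v : V} (hv : v ∈ X) : compOf G X v = X :=
  (compOf_subset G X v).antisymm fun _ hw => ⟨hv, hw, h _ _⟩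

/-- A set meeting a connected set `X` contains `X` as soon as it is closed under adjacency
within `X`. -/
lemma subset_of_preconnected {G : SimpleGraph V} {X K : Set V}
    (h : (G.induce X).Preconnected) {v : V} (hv : v ∈ X) (hvK : v ∈ K)
    (hK : ∀ a ∈ X, ∀ b ∈ X, G.Adj a b → a ∈ K → b ∈ K) : X ⊆ K := by
  rw [← compOf_eq_of_preconnected h hv]
  exact compOf_subset_of_closed (fun _ => hvK) hK

lemma exists_isMinCocSetOn [Finite V] (G : SimpleGraph V) (A : Set V) (d : ℕ) :
    ∃ S, IsMinCocSetOn G A d S := by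
  have : cocOptOn G A d ∈ {m : ℕ | ∃ S : Set V, S ⊆ A ∧ IsCocSetOn G A d S ∧ S.ncard = m} := by
    apply Nat.sInf_mem
    refine ⟨_, A, subset_rfl, ?_, rfl⟩
    rw [isCocSetOn_iff]
    rintro v ⟨h, h'⟩
    exact absurd h h'
  exact this

lemma cocOptOn_le {G : SimpleGraph V} {A : Set V} {d : ℕ} {S : Set V} (h : S ⊆ A)
    (h' : IsCocSetOn G A d S) : cocOptOn G A d ≤ S.ncard :=
  Nat.sInf_le ⟨S, h, h', rfl⟩

/-! ### Structure of spined caterpillars -/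

namespace SubCaterpillar

variable {G : SimpleGraph V} (C : SubCaterpillar G)

/-- The left end of the spine. -/
def first : V := C.spine ⟨0, C.npos⟩

/-- The right end of the spine. -/
def last : V := C.spine ⟨C.n - 1, Nat.sub_lt C.npos Nat.one_pos⟩

lemma first_mem : C.first ∈ C.verts := C.spineMem _

lemma last_mem : C.last ∈ C.verts := C.spineMem _

lemma eq_of_pendant {v w w' : V} (hv : v ∈ C.verts) (hvs : v ∉ Set.range C.spine)
    (hw : w ∈ C.verts) (hvw : G.Adj v w) (hw' : w' ∈ C.verts) (hvw' : G.Adj v w') : w = w' := by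
  obtain ⟨z, hz⟩ := Set.ncard_eq_one.1 (C.pendant v hv hvs)
  have h1 : w ∈ ({z} : Set V) := hz ▸ ⟨hw, hvw⟩
  have h2 : w' ∈ ({z} : Set V) := hz ▸ ⟨hw', hvw'⟩
  rw [Set.mem_singleton_iff] at h1 h2
  rw [h1, h2]

lemma parent_mem_spine {v w : V} (hv : v ∈ C.verts) (hvs : v ∉ Set.range C.spine)
    (hw : w ∈ C.verts) (hvw : G.Adj v w) : w ∈ Set.range C.spine := by
  by_contra hws
  have h : C.verts ⊆ {v, w} := by
    refine subset_of_preconnected C.isTree.1.preconnected hv (by simp) ?_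
    rintro a ha b hb hab (rfl | rfl)
    · right; exact C.eq_of_pendant hv hvs hb hab hw hvw
    · left; exact C.eq_of_pendant hw hws hb hab hv hvw.symm
  rcases h C.first_mem with h | h
  · exact hvs ⟨_, h⟩
  · exact hws ⟨_, h⟩

/-- Every spine edge separates the caterpillar into a left and a right side. -/
lemma exists_cut (k : ℕ) (hk : k + 1 < C.n) :
    ∃ L : Set V, (∀ i : Fin C.n, C.spine i ∈ L ↔ (i : ℕ) ≤ k) ∧
      ∀ u ∈ C.verts, ∀ v ∈ C.verts, u ∈ L → v ∉ L → G.Adj u v →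
        u = C.spine ⟨k, Nat.lt_of_succ_lt hk⟩ ∧ v = C.spine ⟨k + 1, hk⟩ := by
  set T := G.induce C.verts with hT
  let s : Fin C.n → C.verts := fun i => ⟨C.spine i, C.spineMem i⟩
  have hs : Function.Injective s := fun i j h => C.spineInj (Subtype.ext_iff.1 h)
  let a := s ⟨k, Nat.lt_of_succ_lt hk⟩
  let b := s ⟨k + 1, hk⟩
  have hab : T.Adj a b := C.spineAdj k hk
  have hbr : ¬ (T.deleteEdges {s(a, b)}).Reachable a b :=
    SimpleGraph.isBridge_iff.1 (SimpleGraph.isAcyclic_iff_forall_isBridge.1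
      C.isTree.isAcyclic (T.mem_edgeSet.2 hab))
  set D := T.deleteEdges {s(a, b)} with hD
  have hstep : ∀ (i : ℕ) (h : i + 1 < C.n), i ≠ k →
      D.Adj (s ⟨i, Nat.lt_of_succ_lt h⟩) (s ⟨i + 1, h⟩) := by
    intro i h hik
    rw [hD, SimpleGraph.deleteEdges_adj]
    refine ⟨C.spineAdj i h, ?_⟩
    simp only [Set.mem_singleton_iff, Sym2.eq_iff, a, b, hs.eq_iff, Fin.mk.injEq]
    omega
  have hleft : ∀ j (hj : j ≤ k), D.Reachable a (s ⟨k - j, by omega⟩) := by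
    intro j
    induction j with
    | zero => intro _; exact .rfl
    | succ j ih =>
      intro hj
      have h1 := hstep (k - (j + 1)) (by omega) (by omega)
      have h2 := ih (by omega)
      have h3 : k - (j + 1) + 1 = k - j := by omega
      simp only [h3] at h1
      exact h2.trans h1.symm.reachable
  have hright : ∀ j (hj : k + 1 + j < C.n), D.Reachable b (s ⟨k + 1 + j, hj⟩) := by
    intro j
    induction j with
    | zero => intro _; exact .rfl
    | succ j ih =>
      intro hj
      exact (ih (by omega)).trans (hstep (k + 1 + j) (by omega) (by omega)).reachable
  refine ⟨{v | ∃ h : v ∈ C.verts, D.Reachable a ⟨v, h⟩}, ?_, ?_⟩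
  · intro i
    constructor
    · rintro ⟨_, h⟩
      by_contra hi
      have h1 := hright (i - (k + 1)) (by omega)
      have h2 : k + 1 + (i - (k + 1)) = (i : ℕ) := by omega
      simp only [h2] at h1
      exact hbr (h.trans h1.symm)
    · intro hi
      have h1 := hleft (k - i) (by omega)
      have h2 : k - (k - i) = (i : ℕ) := by omega
      simp only [h2] at h1
      exact ⟨C.spineMem i, h1⟩
  · rintro u hu v hv ⟨_, hau⟩ hvL huv
    by_contra hne
    have hnD : ¬ D.Adj ⟨u, hu⟩ ⟨v, hv⟩ := fun h => hvL ⟨hv, hau.trans h.reachable⟩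
    rw [hD, SimpleGraph.deleteEdges_adj] at hnD
    have he : s((⟨u, hu⟩ : C.verts), ⟨v, hv⟩) = s(a, b) := by
      by_contra he
      exact hnD ⟨huv, he⟩
    rw [Sym2.eq_iff] at he
    rcases he with ⟨h1, h2⟩ | ⟨h1, h2⟩
    · exact hne ⟨congrArg Subtype.val h1, congrArg Subtype.val h2⟩
    · exact hbr (h1 ▸ hau)

lemma spine_adj_succ {i j : Fin C.n} (h : G.Adj (C.spine i) (C.spine j)) (hij : i < j) :
    (j : ℕ) = i + 1 := by
  have hk : (i : ℕ) + 1 < C.n := by omega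
  obtain ⟨L, hL, hcut⟩ := C.exists_cut i hk
  have := hcut _ (C.spineMem i) _ (C.spineMem j) ((hL i).2 le_rfl)
    (by rw [hL]; omega) h
  simpa using congrArg Fin.val (C.spineInj this.2)

/-- A set whose component at a spine vertex reaches across a spine edge contains both ends
of this edge. -/
lemma spine_mem_compOf {B : Set V} (hB : B ⊆ C.verts) {i j : Fin C.n}
    (h : C.spine j ∈ compOf G B (C.spine i)) (k : ℕ) (hik : i ≤ k) (hkj : k < j) :
    C.spine ⟨k, by omega⟩ ∈ compOf G B (C.spine i) ∧
      C.spine ⟨k + 1, by omega⟩ ∈ compOf G B (C.spine i) := by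
  obtain ⟨L, hL, hcut⟩ := C.exists_cut k (by omega)
  have hiL : C.spine i ∈ L := (hL i).2 hik
  have hjL : C.spine j ∉ L := by rw [hL]; omega
  by_contra hne
  refine hjL (compOf_subset_of_closed (K := L ∩ compOf G B (C.spine i))
    (fun hi => ⟨hiL, mem_compOf_self hi⟩) ?_ h).1
  rintro a ha b hb hab ⟨haL, hac⟩
  have hbc := mem_compOf_of_adj hac hab hb
  refine ⟨?_, hbc⟩
  by_contra hbL
  obtain ⟨rfl, rfl⟩ := hcut a (hB ha) b (hB hb) haL hbL hab
  exact hne ⟨hac, hbc⟩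

end SubCaterpillar

/-! ### Transversals of solution-tight packings -/

lemma IsSTP.exists_rightmost {G : SimpleGraph V} {d : ℕ} (hd : 1 ≤ d) {C : SubCaterpillar G}
    {Q : Finset (Set V)} (hQ : IsSTP G d C Q) {X : Set V} (hX : X ∈ Q) :
    ∃ j : Fin C.n, C.spine j ∈ X ∧ ∀ j' : Fin C.n, C.spine j' ∈ X → (j' : ℕ) ≤ j := by
  obtain ⟨hsub, hcard, hcon⟩ := hQ.1 X hX
  have hne : ∃ j : Fin C.n, C.spine j ∈ X := by
    by_contra! hno
    have hXs : ∀ v ∈ X, v ∉ Set.range C.spine := by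
      rintro v hv ⟨j, rfl⟩
      exact hno j hv
    obtain ⟨⟨v, hv⟩⟩ := hcon.nonempty
    have : X ⊆ {v} := by
      refine subset_of_preconnected hcon.preconnected hv rfl ?_
      rintro a ha b hb hab -
      exact absurd (C.parent_mem_spine (hsub ha) (hXs a ha) (hsub hb) hab) (hXs b hb)
    have := Set.ncard_le_ncard this
    rw [Set.ncard_singleton] at this
    omega
  obtain ⟨j, hj, hmax⟩ := Set.exists_max_image {j : Fin C.n | C.spine j ∈ X} id
    (Set.toFinite _) hne
  exact ⟨j, hj, fun j' hj' => hmax j' hj'⟩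

/-- The rightmost spine vertices of some graphs of a solution-tight packing form a coc set of
the subgraph covered by these graphs. -/
lemma IsSTP.exists_coc_transversal {G : SimpleGraph V} {d : ℕ} (hd : 1 ≤ d)
    [Finite V] {C : SubCaterpillar G} {Q : Finset (Set V)} (hQ : IsSTP G d C Q)
    {P : Finset (Set V)} (hP : P ⊆ Q) :
    ∃ Y ⊆ ⋃₀ (↑P : Set (Set V)), IsCocSetOn G (⋃₀ (↑P : Set (Set V))) d Y ∧
      Y.ncard ≤ P.card ∧ (C.last ∈ ⋃₀ (↑P : Set (Set V)) → C.last ∈ Y) := by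
  have hr : ∀ X : Set V, ∃ j : Fin C.n, X ∈ Q →
      C.spine j ∈ X ∧ ∀ j' : Fin C.n, C.spine j' ∈ X → (j' : ℕ) ≤ j := by
    intro X
    by_cases hX : X ∈ Q
    · obtain ⟨j, hj⟩ := hQ.exists_rightmost hd hX
      exact ⟨j, fun _ => hj⟩
    · exact ⟨⟨0, C.npos⟩, fun h => absurd h hX⟩
  choose r hr using hr
  obtain ⟨hpc, hdis, -, hpen, -, hright⟩ := hQ
  set Y : Set V := (fun X => C.spine (r X)) '' (↑P : Set (Set V)) with hY
  have noEdge : ∀ X ∈ P, ∀ X' ∈ P, X ≠ X' → ∀ i j : Fin C.n, C.spine i ∈ X →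
      C.spine j ∈ X' → C.spine i ∉ Y → i < j → ¬ G.Adj (C.spine i) (C.spine j) := by
    intro X hX X' hX' hne i j hi hj hiY hij hadj
    have hsucc := C.spine_adj_succ hadj hij
    obtain ⟨hrX, hmax⟩ := hr X (hP hX)
    have hilt : (i : ℕ) < r X := by
      refine lt_of_le_of_ne (hmax i hi) fun h => hiY ⟨X, hX, ?_⟩
      rw [Fin.ext h]
    obtain ⟨hXs, -, hcon⟩ := hpc X (hP hX)
    have := (C.spine_mem_compOf hXs (i := i) (j := r X)
      (by rw [compOf_eq_of_preconnected hcon.preconnected hi]; exact hrX) i le_rfl hilt).2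
    have hjX : C.spine j ∈ X := by
      have hj' : j = ⟨(i : ℕ) + 1, by omega⟩ := Fin.ext hsucc
      rw [hj']
      exact compOf_subset _ _ _ this
    exact Set.disjoint_left.1 (hdis (hP hX) (hP hX') hne) hjX hj
  refine ⟨Y, ?_, ?_, ?_, ?_⟩
  · rintro _ ⟨X, hX, rfl⟩
    exact ⟨X, hX, (hr X (hP hX)).1⟩
  · rw [isCocSetOn_iff]
    rintro v ⟨⟨X, hX, hvX⟩, hvY⟩
    have hX' : X ∈ P := hX
    obtain ⟨hrX, hmax⟩ := hr X (hP hX)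
    have hcoc := hright X (hP hX) (r X) hrX hmax
    refine le_trans (Set.ncard_le_ncard ?_) (hcoc.ncard_compOf_le v)
    refine compOf_subset_of_closed (fun _ => mem_compOf_self ⟨hvX, ?_⟩) ?_
    · rintro rfl
      exact hvY ⟨X, hX, rfl⟩
    · rintro a ⟨-, haY⟩ b ⟨⟨X', hX', hbX'⟩, hbY⟩ hab hac
      have haX : a ∈ X := (compOf_subset _ _ _ hac).1
      have hbX : b ∈ X := by
        by_contra hbX
        have hne : X ≠ X' := by
          rintro rfl
          exact hbX hbX'
        have has : a ∈ Set.range C.spine := by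
          by_contra has
          exact Set.disjoint_left.1 (hdis (hP hX) (hP hX') hne) haX
            (hpen X' (hP hX') a ((hpc X (hP hX)).1 haX) has b hbX' hab)
        have hbs : b ∈ Set.range C.spine := by
          by_contra hbs
          exact hbX (hpen X (hP hX) b ((hpc X' (hP hX')).1 hbX') hbs a haX hab.symm)
        obtain ⟨i, rfl⟩ := has
        obtain ⟨j, rfl⟩ := hbs
        rcases lt_trichotomy i j with h | rfl | h
        · exact noEdge X hX X' hX' hne i j haX hbX' haY h hab
        · exact G.loopless.irrefl _ hab
        · exact noEdge X' hX' X hX hne.symm j i hbX' haX hbY h hab.symm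
      refine mem_compOf_of_adj hac hab ⟨hbX, ?_⟩
      rintro rfl
      exact hbY ⟨X, hX, rfl⟩
  · exact (Set.ncard_image_le).trans (Set.ncard_coe_finset P).le
  · rintro ⟨X, hX, hl⟩
    obtain ⟨-, hmax⟩ := hr X (hP hX)
    have h1 := hmax _ hl
    refine ⟨X, hX, congrArg C.spine (Fin.ext ?_)⟩
    have := (r X).2
    simp only at h1 ⊢
    omega

namespace SubCaterpillar

variable {G : SimpleGraph V} (C : SubCaterpillar G)

lemma spine_mem_compOf_first {S : Set V}
    (h : C.last ∈ compOf G (C.verts \ S) C.first) (i : Fin C.n) :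
    C.spine i ∈ compOf G (C.verts \ S) C.first := by
  by_cases hi : (i : ℕ) = 0
  · have : i = ⟨0, C.npos⟩ := Fin.ext hi
    rw [this]
    exact mem_compOf_self h.1
  · have h1 := (C.spine_mem_compOf Set.sdiff_subset (i := ⟨0, C.npos⟩)
      (j := ⟨C.n - 1, Nat.sub_lt C.npos Nat.one_pos⟩) h (i - 1) (Nat.zero_le _)
      (by simp only; omega)).2
    have h2 : (i : ℕ) - 1 + 1 = i := by omega
    simp only [h2] at h1
    exact h1

lemma sdiff_subset_compOf_first {S : Set V}
    (h : C.last ∈ compOf G (C.verts \ S) C.first) :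
    C.verts \ S ⊆ compOf G (C.verts \ S) C.first := by
  intro a ha
  by_cases has : a ∈ Set.range C.spine
  · obtain ⟨i, rfl⟩ := has
    exact C.spine_mem_compOf_first h i
  · obtain ⟨z, hz⟩ := Set.ncard_eq_one.1 (C.pendant a ha.1 has)
    have hz' : z ∈ {w : V | w ∈ C.verts ∧ G.Adj a w} := hz ▸ rfl
    obtain ⟨i, rfl⟩ := C.parent_mem_spine ha.1 has hz'.1 hz'.2
    exact mem_compOf_of_adj (C.spine_mem_compOf_first h i) hz'.2.symm ha

lemma pos_spine (i : Fin C.n) : C.pos (C.spine i) = i := by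
  have : {k : ℕ | ∃ h : k < C.n, C.spine ⟨k, h⟩ = C.spine i ∨
      (C.spine i ∉ Set.range C.spine ∧ G.Adj (C.spine i) (C.spine ⟨k, h⟩))} = {(i : ℕ)} := by
    ext k
    simp only [Set.mem_ofPred_eq, Set.mem_range_self, not_true_eq_false, false_and, or_false,
      Set.mem_singleton_iff, C.spineInj.eq_iff, Fin.ext_iff]
    exact ⟨fun ⟨_, h⟩ => h, fun h => ⟨h ▸ i.2, h⟩⟩
  rw [pos, this, csInf_singleton]

lemma pos_pendant {v : V} (hv : v ∈ C.verts) (hvs : v ∉ Set.range C.spine) {i : Fin C.n}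
    (h : G.Adj v (C.spine i)) : C.pos v = i := by
  have : {k : ℕ | ∃ h : k < C.n, C.spine ⟨k, h⟩ = v ∨
      (v ∉ Set.range C.spine ∧ G.Adj v (C.spine ⟨k, h⟩))} = {(i : ℕ)} := by
    ext k
    simp only [Set.mem_ofPred_eq, Set.mem_singleton_iff]
    constructor
    · rintro ⟨hk, rfl | ⟨-, h'⟩⟩
      · exact absurd ⟨_, rfl⟩ hvs
      · exact congrArg Fin.val
          (C.spineInj (C.eq_of_pendant hv hvs (C.spineMem ⟨k, hk⟩) h' (C.spineMem i) h))
    · rintro rfl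
      exact ⟨i.2, Or.inr ⟨hvs, h⟩⟩
  rw [pos, this, csInf_singleton]

/-- If the spine of `D` is the part of the spine of `C` inside `D`, then every vertex of `D` is
positioned in `C` at some spine vertex of `D`. -/
lemma exists_spine_eq_pos {D : SubCaterpillar G} (hDC : D.verts ⊆ C.verts)
    (hr : Set.range D.spine = Set.range C.spine ∩ D.verts) {a : V} (ha : a ∈ D.verts) :
    ∃ (i : Fin D.n) (j : Fin C.n), D.spine i = C.spine j ∧ C.pos a = j := by
  by_cases has : a ∈ Set.range D.spine
  · obtain ⟨i, rfl⟩ := has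
    have : D.spine i ∈ Set.range C.spine ∩ D.verts := hr ▸ ⟨i, rfl⟩
    obtain ⟨⟨j, hj⟩, -⟩ := this
    exact ⟨i, j, hj.symm, by rw [← hj, pos_spine]⟩
  · obtain ⟨z, hz⟩ := Set.ncard_eq_one.1 (D.pendant a ha has)
    have hz' : z ∈ {w : V | w ∈ D.verts ∧ G.Adj a w} := hz ▸ rfl
    obtain ⟨i, rfl⟩ := D.parent_mem_spine ha has hz'.1 hz'.2
    have : D.spine i ∈ Set.range C.spine ∩ D.verts := hr ▸ ⟨i, rfl⟩
    obtain ⟨⟨j, hj⟩, -⟩ := this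
    have hac : a ∉ Set.range C.spine := fun h => has (hr ▸ ⟨h, ha⟩)
    exact ⟨i, j, hj.symm, C.pos_pendant (hDC ha) hac (hj ▸ hz'.2)⟩

end SubCaterpillar

lemma card_mul_le_ncard_sUnion [Finite V] {m : ℕ} (P : Finset (Set V))
    (hdis : (↑P : Set (Set V)).Pairwise fun A B => Disjoint A B)
    (hcard : ∀ X ∈ P, m ≤ X.ncard) : P.card * m ≤ (⋃₀ (↑P : Set (Set V))).ncard := by
  classical
  induction P using Finset.induction_on with
  | empty => simp
  | insert X P hX ih =>
    rw [Finset.coe_insert] at hdis ⊢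
    rw [Set.sUnion_insert, Set.ncard_union_eq, Finset.card_insert_of_notMem hX, add_mul, one_mul,
      add_comm]
    · exact add_le_add (hcard X (Finset.mem_insert_self X P))
        (ih (hdis.mono (Set.subset_insert _ _)) fun Y hY => hcard Y (Finset.mem_insert_of_mem hY))
    · rw [Set.disjoint_sUnion_right]
      intro Y hY
      refine hdis (Set.mem_insert _ _) (Set.mem_insert_of_mem _ hY) ?_
      rintro rfl
      exact hX hY

/-! ### Subsets of disjoint unions -/

/-- The subset of `A ⊕ W` consisting of the vertices of `B` and of `D`. -/
def sumSet (A B : Set V) (D : Set W) : Set (A ⊕ W) :=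
  {p | Sum.elim (fun u : A => (u : V) ∈ B) (fun w => w ∈ D) p}

@[simp] lemma inl_mem_sumSet {A B : Set V} {D : Set W} {u : A} :
    (Sum.inl u : A ⊕ W) ∈ sumSet A B D ↔ (u : V) ∈ B := Iff.rfl

@[simp] lemma inr_mem_sumSet {A B : Set V} {D : Set W} {w : W} :
    (Sum.inr w : A ⊕ W) ∈ sumSet A B D ↔ w ∈ D := Iff.rfl

lemma ncard_sumSet [Finite V] [Finite W] {A B : Set V} (hB : B ⊆ A) (D : Set W) :
    (sumSet A B D).ncard = B.ncard + D.ncard := by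
  have h : sumSet A B D = Sum.inl '' (Subtype.val ⁻¹' B : Set A) ∪ Sum.inr '' D := by
    ext (u | w) <;> simp
  rw [h, Set.ncard_union_eq, Set.ncard_image_of_injective _ Sum.inl_injective,
    Set.ncard_image_of_injective _ Sum.inr_injective,
    Set.ncard_preimage_of_injective_subset_range Subtype.val_injective (by simpa using hB)]
  rw [Set.disjoint_left]
  rintro _ ⟨u, -, rfl⟩ ⟨w, -, h⟩
  exact absurd h (by simp)

/-! ### Attaching pendants and the essence -/

section Attach

variable {G : SimpleGraph V} {A : Set V} {a₀ : V} {h₀ : a₀ ∈ A} {x : ℕ}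

lemma attachPendants_adj_inl {K : SimpleGraph W} {v u u' : W} :
    (attachPendants K v x).Adj (Sum.inl u) (Sum.inl u') ↔ K.Adj u u' := by
  simp only [attachPendants, SimpleGraph.fromRel_adj]
  constructor
  · rintro ⟨-, (⟨_, _, h1, h2, h⟩ | ⟨_, _, h⟩) | (⟨_, _, h1, h2, h⟩ | ⟨_, _, h⟩)⟩
    · cases h1; cases h2; exact h
    · cases h
    · cases h1; cases h2; exact h.symm
    · cases h
  · exact fun h => ⟨fun h' => h.ne (Sum.inl_injective h'), Or.inl (Or.inl ⟨_, _, rfl, rfl, h⟩)⟩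

lemma attachPendants_adj_inl_inr {K : SimpleGraph W} {v u : W} {i : Fin x} :
    (attachPendants K v x).Adj (Sum.inl u) (Sum.inr i) ↔ u = v := by
  simp [attachPendants, SimpleGraph.fromRel_adj]

lemma not_attachPendants_adj_inr {K : SimpleGraph W} {v : W} {i j : Fin x} :
    ¬ (attachPendants K v x).Adj (Sum.inr i) (Sum.inr j) := by
  simp [attachPendants, SimpleGraph.fromRel_adj]

lemma sumSet_compOf_subset {S : Set V} {Y : Set (A ⊕ Fin x)}
    (hSY : ∀ u (h : u ∈ A), u ∉ S → Sum.inl ⟨u, h⟩ ∉ Y) {v : V} (hv : v ∈ A) :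
    sumSet A (compOf G (A \ S) v) (∅ : Set (Fin x)) ⊆
      compOf (attachPendants (G.induce A) ⟨a₀, h₀⟩ x) (Set.univ \ Y) (Sum.inl ⟨v, hv⟩) := by
  rintro (⟨u, hu⟩ | i) h
  · have hsub : compOf G (A \ S) v ⊆ {u | ∃ h : u ∈ A, Sum.inl ⟨u, h⟩ ∈
        compOf (attachPendants (G.induce A) ⟨a₀, h₀⟩ x) (Set.univ \ Y) (Sum.inl ⟨v, hv⟩)} := by
      refine compOf_subset_of_closed (fun h => ⟨hv, mem_compOf_self ⟨trivial, hSY v hv h.2⟩⟩) ?_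
      rintro a - b hb hab ⟨ha, hac⟩
      exact ⟨hb.1, mem_compOf_of_adj hac (attachPendants_adj_inl.2 hab)
        ⟨trivial, hSY b hb.1 hb.2⟩⟩
    exact (hsub h).2
  · exact absurd h (by simp)

lemma compOf_attachPendants {S : Set V} {v : V} (hv : v ∈ A \ S) :
    compOf (attachPendants (G.induce A) ⟨a₀, h₀⟩ x) (Set.univ \ sumSet A S ∅) (Sum.inl ⟨v, hv.1⟩) =
      sumSet A (compOf G (A \ S) v) {_i : Fin x | a₀ ∈ compOf G (A \ S) v} := by
  have hin : sumSet A (compOf G (A \ S) v) (∅ : Set (Fin x)) ⊆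
      compOf (attachPendants (G.induce A) ⟨a₀, h₀⟩ x) (Set.univ \ sumSet A S ∅)
        (Sum.inl ⟨v, hv.1⟩) :=
    sumSet_compOf_subset (fun u _ hu => hu) hv.1
  apply Set.Subset.antisymm
  · refine compOf_subset_of_closed (fun _ => mem_compOf_self hv) ?_
    rintro (a | i) ⟨-, ha⟩ (b | j) ⟨-, hb⟩ hab hac
    · have hab' : (G.induce A).Adj a b := attachPendants_adj_inl.1 hab
      exact mem_compOf_of_adj (G := G) hac hab' ⟨b.2, hb⟩
    · have := attachPendants_adj_inl_inr.1 hab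
      subst this
      exact hac
    · have := attachPendants_adj_inl_inr.1 hab.symm
      subst this
      exact hac
    · exact absurd hab not_attachPendants_adj_inr
  · rintro (u | i) h
    · exact hin h
    · have h' : a₀ ∈ compOf G (A \ S) v := h
      exact mem_compOf_of_adj (hin (a := Sum.inl ⟨a₀, h₀⟩) h')
        (attachPendants_adj_inl_inr.2 rfl) ⟨trivial, id⟩

lemma ncard_setOf_const (p : Prop) [Decidable p] :
    {_i : Fin x | p}.ncard = if p then x else 0 := by
  split_ifs with h <;> simp [h]

lemma ncard_compOf_attachPendants [Finite V] {S : Set V} {v : V} (hv : v ∈ A)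
    [Decidable (a₀ ∈ compOf G (A \ S) v)] :
    (compOf (attachPendants (G.induce A) ⟨a₀, h₀⟩ x) (Set.univ \ sumSet A S ∅)
      (Sum.inl ⟨v, hv⟩)).ncard =
      (compOf G (A \ S) v).ncard + if a₀ ∈ compOf G (A \ S) v then x else 0 := by
  by_cases hvS : v ∈ S
  · have h1 : v ∉ A \ S := fun h => h.2 hvS
    rw [compOf_eq_empty (B := Set.univ \ sumSet A S ∅)
      (v := Sum.inl ⟨v, hv⟩) fun h => h.2 hvS]
    simp [compOf_eq_empty h1]
  · rw [compOf_attachPendants ⟨hv, hvS⟩,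
      ncard_sumSet ((compOf_subset _ _ _).trans Set.sdiff_subset), ncard_setOf_const]

lemma isCocSetOn_attachPendants_iff [Finite V] {d : ℕ} (hd : 1 ≤ d) {S : Set V} :
    IsCocSetOn (attachPendants (G.induce A) ⟨a₀, h₀⟩ x) Set.univ d (sumSet A S ∅) ↔
      IsCocSetOn G A d S ∧ (a₀ ∉ S → x + (compOf G (A \ S) a₀).ncard ≤ d) := by
  classical
  constructor
  · intro h
    refine ⟨?_, fun ha => ?_⟩
    · rw [isCocSetOn_iff]
      intro v hv
      have := h.ncard_compOf_le (Sum.inl ⟨v, hv.1⟩)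
      rw [ncard_compOf_attachPendants] at this
      omega
    · have := h.ncard_compOf_le (Sum.inl ⟨a₀, h₀⟩)
      rw [ncard_compOf_attachPendants,
        if_pos (show a₀ ∈ compOf G (A \ S) a₀ from mem_compOf_self ⟨h₀, ha⟩)] at this
      omega
  · rintro ⟨h, h'⟩
    have hinl : ∀ v (hv : v ∈ A),
        (compOf (attachPendants (G.induce A) ⟨a₀, h₀⟩ x) (Set.univ \ sumSet A S ∅)
          (Sum.inl ⟨v, hv⟩)).ncard ≤ d := by
      intro v hv
      rw [ncard_compOf_attachPendants]
      split_ifs with hm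
      · have := h' (compOf_subset _ _ _ hm).2
        rw [compOf_eq_of_mem hm] at this
        omega
      · exact h.ncard_compOf_le v
    rw [isCocSetOn_iff]
    rintro (⟨v, hv⟩ | i) -
    · exact hinl v hv
    · by_cases ha : a₀ ∈ S
      · refine (Set.ncard_le_ncard (t := {Sum.inr i}) ?_).trans (by simpa using hd)
        refine compOf_subset_of_closed (fun _ => rfl) ?_
        rintro a - (b | j) ⟨-, hb⟩ hab rfl
        · have := attachPendants_adj_inl_inr.1 hab.symm
          subst this
          exact absurd ha hb
        · exact absurd hab not_attachPendants_adj_inr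
      · have hmem : Sum.inr i ∈ compOf (attachPendants (G.induce A) ⟨a₀, h₀⟩ x)
            (Set.univ \ sumSet A S ∅) (Sum.inl ⟨a₀, h₀⟩) :=
          mem_compOf_of_adj (mem_compOf_self ⟨trivial, ha⟩)
            (attachPendants_adj_inl_inr.2 rfl) ⟨trivial, id⟩
        rw [compOf_eq_of_mem hmem]
        exact hinl a₀ h₀

/-- The trace on `A` of a set of vertices of the graph with attached pendants. -/
def trace (Y : Set (A ⊕ Fin x)) : Set V := {v | ∃ h : v ∈ A, Sum.inl ⟨v, h⟩ ∈ Y}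

lemma trace_subset (Y : Set (A ⊕ Fin x)) : trace Y ⊆ A := fun _ h => h.1

lemma sumSet_trace_subset (Y : Set (A ⊕ Fin x)) : sumSet A (trace Y) ∅ ⊆ Y := by
  rintro (u | i) h
  · exact h.2
  · exact absurd h (by simp)

lemma isCocSetOn_trace [Finite V] {d : ℕ} {Y : Set (A ⊕ Fin x)}
    (h : IsCocSetOn (attachPendants (G.induce A) ⟨a₀, h₀⟩ x) Set.univ d Y) :
    IsCocSetOn G A d (trace Y) := by
  rw [isCocSetOn_iff]
  intro v hv
  refine le_trans ?_ (h.ncard_compOf_le (Sum.inl ⟨v, hv.1⟩))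
  rw [← add_zero (Set.ncard _), ← Set.ncard_empty (Fin x),
    ← ncard_sumSet ((compOf_subset _ _ _).trans Set.sdiff_subset)]
  exact Set.ncard_le_ncard (sumSet_compOf_subset (S := trace Y) (fun u hu hu' hY => hu' ⟨hu, hY⟩) hv.1)

lemma ncard_trace [Finite V] (Y : Set (A ⊕ Fin x)) :
    (trace Y).ncard = (sumSet A (trace Y) (∅ : Set (Fin x))).ncard := by
  rw [ncard_sumSet (trace_subset Y), Set.ncard_empty, add_zero]

lemma cocOptOn_le_attachPendants [Finite V] {d : ℕ} :
    cocOptOn G A d ≤ cocOptOn (attachPendants (G.induce A) ⟨a₀, h₀⟩ x) Set.univ d := by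
  obtain ⟨Y, -, hY, hc⟩ := exists_isMinCocSetOn
    (attachPendants (G.induce A) ⟨a₀, h₀⟩ x) Set.univ d
  rw [← hc]
  refine (cocOptOn_le (trace_subset Y) (isCocSetOn_trace hY)).trans ?_
  rw [ncard_trace]
  exact Set.ncard_le_ncard (sumSet_trace_subset Y)

end Attach

namespace SubCaterpillar

lemma essence_eq {G : SimpleGraph V} (C : SubCaterpillar G) (d x : ℕ) :
    C.essence d x =
      if x ≤ d ∧ cocOptOn (attachPendants (G.induce C.verts) ⟨C.first, C.first_mem⟩ x)
        Set.univ d = cocOptOn G C.verts d then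
        sInf {b : ℕ | ∃ Y : Set (↥C.verts ⊕ Fin x),
          IsMinCocSetOn (attachPendants (G.induce C.verts) ⟨C.first, C.first_mem⟩ x)
            Set.univ d Y ∧
          b = compSizeOn (attachPendants (G.induce C.verts) ⟨C.first, C.first_mem⟩ x)
            Set.univ Y (Sum.inl ⟨C.last, C.last_mem⟩)}
      else d + 1 := rfl

open Classical in
lemma essence_le [Finite V] {G : SimpleGraph V} (C : SubCaterpillar G) {d x : ℕ} (hd : 1 ≤ d)
    (hx : x ≤ d) {S : Set V} (hS : IsMinCocSetOn G C.verts d S)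
    (hfirst : C.first ∉ S → x + (compOf G (C.verts \ S) C.first).ncard ≤ d) :
    C.essence d x ≤ (compOf G (C.verts \ S) C.last).ncard +
      if C.first ∈ compOf G (C.verts \ S) C.last then x else 0 := by
  obtain ⟨hsub, hcoc, hcard⟩ := hS
  have hext := (isCocSetOn_attachPendants_iff (h₀ := C.first_mem) (x := x) hd).2 ⟨hcoc, hfirst⟩
  have hn : (sumSet C.verts S (∅ : Set (Fin x))).ncard = cocOptOn G C.verts d := by
    rw [ncard_sumSet hsub, Set.ncard_empty, add_zero, hcard]
  have hopt : cocOptOn (attachPendants (G.induce C.verts) ⟨C.first, C.first_mem⟩ x)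
      Set.univ d = cocOptOn G C.verts d :=
    le_antisymm (hn ▸ cocOptOn_le (Set.subset_univ _) hext) cocOptOn_le_attachPendants
  rw [← ncard_compOf_attachPendants (h₀ := C.first_mem) C.last_mem]
  rw [essence_eq, if_pos ⟨hx, hopt⟩]
  exact Nat.sInf_le ⟨_, ⟨Set.subset_univ _, hext, hn.trans hopt.symm⟩, rfl⟩

open Classical in
lemma exists_of_essence_le [Finite V] {G : SimpleGraph V} (C : SubCaterpillar G) {d x y : ℕ}
    (hd : 1 ≤ d) (hy : y ≤ d) (h : C.essence d x ≤ y) :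
    ∃ S, IsMinCocSetOn G C.verts d S ∧
      (C.first ∉ S → x + (compOf G (C.verts \ S) C.first).ncard ≤ d) ∧
      ((compOf G (C.verts \ S) C.last).ncard +
        if C.first ∈ compOf G (C.verts \ S) C.last then x else 0) ≤ y := by
  by_cases hif : x ≤ d ∧ cocOptOn (attachPendants (G.induce C.verts) ⟨C.first, C.first_mem⟩ x)
      Set.univ d = cocOptOn G C.verts d
  · obtain ⟨Y, ⟨-, hYcoc, hYc⟩, hYe⟩ : C.essence d x ∈ {b : ℕ | ∃ Y : Set (↥C.verts ⊕ Fin x),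
        IsMinCocSetOn (attachPendants (G.induce C.verts) ⟨C.first, C.first_mem⟩ x) Set.univ d Y ∧
        b = compSizeOn (attachPendants (G.induce C.verts) ⟨C.first, C.first_mem⟩ x) Set.univ Y
          (Sum.inl ⟨C.last, C.last_mem⟩)} := by
      rw [essence_eq, if_pos hif]
      apply Nat.sInf_mem
      obtain ⟨Y, hY⟩ := exists_isMinCocSetOn
        (attachPendants (G.induce C.verts) ⟨C.first, C.first_mem⟩ x) Set.univ d
      exact ⟨_, Y, hY, rfl⟩
    have hle := cocOptOn_le (trace_subset Y) (isCocSetOn_trace hYcoc)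
    have hge := Set.ncard_le_ncard (sumSet_trace_subset Y)
    rw [← ncard_trace] at hge
    have hYeq : sumSet C.verts (trace Y) ∅ = Y :=
      Set.eq_of_subset_of_ncard_le (sumSet_trace_subset Y) (by rw [← ncard_trace]; omega)
    rw [← hYeq] at hYcoc hYe
    obtain ⟨h1, h2⟩ := (isCocSetOn_attachPendants_iff hd).1 hYcoc
    refine ⟨trace Y, ⟨trace_subset Y, h1, by omega⟩, h2, ?_⟩
    rw [← ncard_compOf_attachPendants (h₀ := C.first_mem) C.last_mem]
    exact hYe.symm.trans_le h
  · have : C.essence d x = d + 1 := by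
      rw [essence_eq, if_neg hif]
    omega

end SubCaterpillar

/-! ### Replacing a connected subgraph -/

/-- The union of the components of `G[B]` at the vertices satisfying `L`. -/
def compsAt (G : SimpleGraph V) (B : Set V) (L : V → Prop) : Set V :=
  {v | ∃ u, L u ∧ v ∈ compOf G B u}

section CompsAt

variable {G : SimpleGraph V} {B : Set V} {L : V → Prop}

lemma compsAt_subset : compsAt G B L ⊆ B := by
  rintro v ⟨u, -, h⟩
  exact compOf_subset _ _ _ h

lemma mem_compsAt {u : V} (hL : L u) (hu : u ∈ B) : u ∈ compsAt G B L :=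
  ⟨u, hL, mem_compOf_self hu⟩

lemma mem_compsAt_of_adj {a b : V} (ha : a ∈ compsAt G B L) (hab : G.Adj a b) (hb : b ∈ B) :
    b ∈ compsAt G B L := by
  obtain ⟨u, hu, h⟩ := ha
  exact ⟨u, hu, mem_compOf_of_adj h hab hb⟩

lemma compsAt_eq_compOf (hL : ∀ u u', L u → L u' → u = u') {v : V} (hv : v ∈ compsAt G B L) :
    compsAt G B L = compOf G B v := by
  obtain ⟨u, hu, h⟩ := hv
  rw [compOf_eq_of_mem h]
  ext w
  constructor
  · rintro ⟨u', hu', h'⟩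
    rwa [hL u u' hu hu']
  · exact fun h' => ⟨u, hu, h'⟩

lemma ncard_compsAt_le {d : ℕ} (hL : ∀ u u', L u → L u' → u = u')
    (hB : ∀ v, (compOf G B v).ncard ≤ d) : (compsAt G B L).ncard ≤ d := by
  rcases (compsAt G B L).eq_empty_or_nonempty with h | ⟨v, hv⟩
  · simp [h]
  · rw [compsAt_eq_compOf hL hv]
    exact hB v

lemma compsAt_subset_compOf {B' : Set V} (hB : B ⊆ B') {a : V} (ha : a ∈ B')
    (hL : ∀ u, L u → G.Adj u a) : compsAt G B L ⊆ compOf G B' a := by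
  rintro v ⟨u, hu, h⟩
  have hu' : u ∈ compOf G B' a := mem_compOf_of_adj (mem_compOf_self ha) (hL u hu).symm (hB h.1)
  rw [← compOf_eq_of_mem hu']
  exact compOf_mono hB u h

end CompsAt

/-- A criterion for a coc set of the graph obtained by gluing `H` to `G − A` along the edges from
`L` to `w₀` and from `R` to `w₁`. -/
lemma isCocSetOn_glue [Finite V] [Finite W] {G : SimpleGraph V} {H : SimpleGraph W} {A S : Set V}
    {Y : Set W} {d : ℕ} {L R : V → Prop} {w₀ w₁ : W} {G' : SimpleGraph (A ⊕ W)}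
    (hG : ∀ u u' : A, G'.Adj (Sum.inl u) (Sum.inl u') → G.Adj (u : V) (u' : V))
    (hH : ∀ w w' : W, G'.Adj (Sum.inr w) (Sum.inr w') → H.Adj w w')
    (hGH : ∀ (u : A) (w : W), G'.Adj (Sum.inl u) (Sum.inr w) →
      (L u ∧ w = w₀) ∨ (R u ∧ w = w₁))
    (hS : ∀ v, (compOf G (A \ S) v).ncard ≤ d) (hY : IsCocSetOn H Set.univ d Y)
    (hl : (compsAt G (A \ S) L).ncard + (compOf H (Set.univ \ Y) w₀).ncard ≤ d)
    (hr : (compsAt G (A \ S) R).ncard + (compOf H (Set.univ \ Y) w₁).ncard ≤ d)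
    (hlr : (compsAt G (A \ S) L ∩ compsAt G (A \ S) R).Nonempty ∨
        (compOf H (Set.univ \ Y) w₀ ∩ compOf H (Set.univ \ Y) w₁).Nonempty →
      (compsAt G (A \ S) L ∪ compsAt G (A \ S) R).ncard +
        (compOf H (Set.univ \ Y) w₀ ∪ compOf H (Set.univ \ Y) w₁).ncard ≤ d) :
    IsCocSetOn G' Set.univ d (sumSet A S Y) := by
  set B := A \ S with hB
  set U := Set.univ \ Y with hU
  have hclosed : ∀ (X : Set V) (Z : Set W), X ⊆ B →
      (∀ a ∈ X, ∀ b ∈ B, G.Adj a b → b ∈ X) → (∀ a ∈ Z, ∀ b ∈ U, H.Adj a b → b ∈ Z) →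
      (∀ u ∈ B, L u → w₀ ∈ U → (u ∈ X ↔ w₀ ∈ Z)) → (∀ u ∈ B, R u → w₁ ∈ U → (u ∈ X ↔ w₁ ∈ Z)) →
      X.ncard + Z.ncard ≤ d →
      ∀ p ∈ sumSet A X Z, (compOf G' (Set.univ \ sumSet A S Y) p).ncard ≤ d := by
    intro X Z hXB hX hZ hL hR hcard p hp
    rw [← ncard_sumSet (hXB.trans Set.sdiff_subset)] at hcard
    refine (Set.ncard_le_ncard ?_).trans hcard
    have hcross : ∀ (u : A) (w : W), (u : V) ∉ S → w ∉ Y → G'.Adj (Sum.inl u) (Sum.inr w) →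
        ((u : V) ∈ X ↔ w ∈ Z) := by
      intro u w hu hw huw
      rcases hGH u w huw with ⟨h, rfl⟩ | ⟨h, rfl⟩
      · exact hL u ⟨u.2, hu⟩ h ⟨trivial, hw⟩
      · exact hR u ⟨u.2, hu⟩ h ⟨trivial, hw⟩
    refine compOf_subset_of_closed (fun _ => hp) ?_
    rintro (a | a) ⟨-, ha⟩ (b | b) ⟨-, hb⟩ hab hac
    · exact hX a hac b ⟨b.2, hb⟩ (hG a b hab)
    · exact (hcross a b ha hb hab).1 hac
    · exact (hcross b a hb ha hab.symm).2 hac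
    · exact hZ a hac b ⟨trivial, hb⟩ (hH a b hab)
  have closedComp : ∀ w, ∀ a ∈ compOf H U w, ∀ b ∈ U, H.Adj a b → b ∈ compOf H U w :=
    fun w a ha b hb hab => mem_compOf_of_adj ha hab hb
  have closedAt : ∀ K : V → Prop, ∀ a ∈ compsAt G B K, ∀ b ∈ B, G.Adj a b →
      b ∈ compsAt G B K :=
    fun K a ha b hb hab => mem_compsAt_of_adj ha hab hb
  rw [isCocSetOn_iff]
  intro p hp
  by_cases hmeet : p ∈ sumSet A (compsAt G B L ∪ compsAt G B R) (compOf H U w₀ ∪ compOf H U w₁)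
  · by_cases hj : (compsAt G B L ∩ compsAt G B R).Nonempty ∨
        (compOf H U w₀ ∩ compOf H U w₁).Nonempty
    · refine hclosed _ _ (Set.union_subset compsAt_subset compsAt_subset) ?_ ?_ ?_ ?_ (hlr hj)
        p hmeet
      · rintro a (ha | ha) b hb hab
        · exact Or.inl (closedAt _ a ha b hb hab)
        · exact Or.inr (closedAt _ a ha b hb hab)
      · rintro a (ha | ha) b hb hab
        · exact Or.inl (closedComp _ a ha b hb hab)
        · exact Or.inr (closedComp _ a ha b hb hab)
      · exact fun u hu hLu hw => iff_of_true (Or.inl (mem_compsAt hLu hu))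
          (Or.inl (mem_compOf_self hw))
      · exact fun u hu hRu hw => iff_of_true (Or.inr (mem_compsAt hRu hu))
          (Or.inr (mem_compOf_self hw))
    · push Not at hj
      rw [← Set.disjoint_iff_inter_eq_empty, ← Set.disjoint_iff_inter_eq_empty,
        Set.disjoint_left, Set.disjoint_left] at hj
      have hp' : p ∈ sumSet A (compsAt G B L) (compOf H U w₀) ∨
          p ∈ sumSet A (compsAt G B R) (compOf H U w₁) := by
        rcases p with u | w
        · exact hmeet
        · exact hmeet
      rcases hp' with hp' | hp'
      · refine hclosed _ _ compsAt_subset (closedAt _) (closedComp _) ?_ ?_ hl p hp'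
        · exact fun u hu hLu hw => iff_of_true (mem_compsAt hLu hu) (mem_compOf_self hw)
        · exact fun u hu hRu hw => iff_of_false (fun h => hj.1 h (mem_compsAt hRu hu))
            (fun h => hj.2 h (mem_compOf_self hw))
      · refine hclosed _ _ compsAt_subset (closedAt _) (closedComp _) ?_ ?_ hr p hp'
        · exact fun u hu hLu hw => iff_of_false (fun h => hj.1 (mem_compsAt hLu hu) h)
            (fun h => hj.2 (mem_compOf_self hw) h)
        · exact fun u hu hRu hw => iff_of_true (mem_compsAt hRu hu) (mem_compOf_self hw)
  · rcases p with u | w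
    · have huX : (u : V) ∉ compsAt G B L ∪ compsAt G B R := hmeet
      refine hclosed (compOf G B u) ∅ (compOf_subset _ _ _)
        (fun a ha b hb hab => mem_compOf_of_adj ha hab hb) (by simp) ?_ ?_ (by simpa using hS u) _
        (mem_compOf_self (G := G) ⟨u.2, hp.2⟩)
      · exact fun u' _ h _ => iff_of_false (fun hu' => huX (Or.inl ⟨u', h, mem_compOf_symm hu'⟩))
          (Set.notMem_empty _)
      · exact fun u' _ h _ => iff_of_false (fun hu' => huX (Or.inr ⟨u', h, mem_compOf_symm hu'⟩))
          (Set.notMem_empty _)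
    · have hwZ : w ∉ compOf H U w₀ ∪ compOf H U w₁ := hmeet
      refine hclosed ∅ (compOf H U w) (Set.empty_subset _) (by simp) (closedComp w) ?_ ?_
        (by simpa using hY.ncard_compOf_le w) _ (mem_compOf_self (G := H) hp)
      · exact fun u' _ _ _ => iff_of_false (Set.notMem_empty _)
          (fun h => hwZ (Or.inl (mem_compOf_symm h)))
      · exact fun u' _ _ _ => iff_of_false (Set.notMem_empty _)
          (fun h => hwZ (Or.inr (mem_compOf_symm h)))

lemma IsCocSetOn.mono [Finite V] {G : SimpleGraph V} {A A' S S' : Set V} {d : ℕ}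
    (h : IsCocSetOn G A d S) (hsub : A' \ S' ⊆ A \ S) : IsCocSetOn G A' d S' := by
  rw [isCocSetOn_iff]
  exact fun v _ => (Set.ncard_le_ncard (compOf_mono hsub v)).trans (h.ncard_compOf_le v)

/-- Gluing bounds for a coc set that is minimum on the replaced caterpillar: the replacement
admits a minimum coc set satisfying the hypotheses of `isCocSetOn_glue`. -/
lemma exists_minCoc_glue [Finite V] [Finite W] {G : SimpleGraph V} {H : SimpleGraph W} {d : ℕ}
    (hd : 1 ≤ d) (C : SubCaterpillar G) (C' : SubCaterpillar H)
    (hess : ∀ x ≤ d + 1, C.essence d x = C'.essence d x) {L R : V → Prop}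
    (hL : ∀ u u', L u → L u' → u = u') (hR : ∀ u u', R u → R u' → u = u')
    (hLadj : ∀ u, L u → G.Adj u C.first) (hRadj : ∀ u, R u → G.Adj u C.last) {S : Set V}
    (hS : IsCocSetOn G Set.univ d S)
    (hcard : (S ∩ C.verts).ncard = cocOptOn G C.verts d)
    (hthrough : C.last ∈ compOf G (C.verts \ S) C.first →
      d ≤ (compOf G (C.verts \ S) C.first).ncard) :
    ∃ Y, IsMinCocSetOn H C'.verts d Y ∧
      (compsAt G (C.vertsᶜ \ S) L).ncard + (compOf H (C'.verts \ Y) C'.first).ncard ≤ d ∧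
      (compsAt G (C.vertsᶜ \ S) R).ncard + (compOf H (C'.verts \ Y) C'.last).ncard ≤ d ∧
      ((compsAt G (C.vertsᶜ \ S) L ∩ compsAt G (C.vertsᶜ \ S) R).Nonempty ∨
          (compOf H (C'.verts \ Y) C'.first ∩ compOf H (C'.verts \ Y) C'.last).Nonempty →
        (compsAt G (C.vertsᶜ \ S) L ∪ compsAt G (C.vertsᶜ \ S) R).ncard +
          (compOf H (C'.verts \ Y) C'.first ∪ compOf H (C'.verts \ Y) C'.last).ncard ≤ d) := by
  classical
  set B := C.vertsᶜ \ S with hB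
  set A := C.verts \ S with hA
  have hAB : ∀ {X Z : Set V}, X ⊆ B → Z ⊆ A → (X ∪ Z).ncard = X.ncard + Z.ncard :=
    fun hX hZ => Set.ncard_union_eq
      (Set.disjoint_left.2 fun v hv hv' => (hX hv).1 (hZ hv').1)
  have hBS : B ⊆ Set.univ \ S := fun v hv => ⟨trivial, hv.2⟩
  have hAS : A ⊆ Set.univ \ S := fun v hv => ⟨trivial, hv.2⟩
  have hA' : C.verts \ (S ∩ C.verts) = A := by
    ext v; simp only [A, Set.mem_sdiff, Set.mem_inter_iff]; tauto
  have hmin : IsMinCocSetOn G C.verts d (S ∩ C.verts) :=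
    ⟨Set.inter_subset_right, hS.mono (hA' ▸ hAS), hcard⟩
  have hBd : ∀ v, (compOf G B v).ncard ≤ d := fun v =>
    (Set.ncard_le_ncard (compOf_mono hBS v)).trans (hS.ncard_compOf_le v)
  set Xl := compsAt G B L with hXl
  set Xr := compsAt G B R with hXr
  set Al := compOf G A C.first with hAl
  set Ar := compOf G A C.last with hAr
  have hXlB : Xl ⊆ B := compsAt_subset
  have hXrB : Xr ⊆ B := compsAt_subset
  have hAlA : Al ⊆ A := compOf_subset _ _ _
  have hArA : Ar ⊆ A := compOf_subset _ _ _
  have hXld : Xl.ncard ≤ d := ncard_compsAt_le hL hBd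
  have hXrd : Xr.ncard ≤ d := ncard_compsAt_le hR hBd
  have hKl : Al.Nonempty → Xl ∪ Al ⊆ compOf G (Set.univ \ S) C.first := by
    rintro ⟨z, hz⟩
    exact Set.union_subset (compsAt_subset_compOf hBS (hAS hz.1) hLadj) (compOf_mono hAS _)
  have hKr : Ar.Nonempty → Xr ∪ Ar ⊆ compOf G (Set.univ \ S) C.last := by
    rintro ⟨z, hz⟩
    exact Set.union_subset (compsAt_subset_compOf hBS (hAS hz.1) hRadj) (compOf_mono hAS _)
  have hl : Al.Nonempty → Xl.ncard + Al.ncard ≤ d := fun h => by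
    rw [← hAB hXlB hAlA]
    exact (Set.ncard_le_ncard (hKl h)).trans (hS.ncard_compOf_le _)
  have hr : Xr.ncard + Ar.ncard ≤ d := by
    rcases Ar.eq_empty_or_nonempty with h | h
    · simpa [h] using hXrd
    · rw [← hAB hXrB hArA]
      exact (Set.ncard_le_ncard (hKr h)).trans (hS.ncard_compOf_le _)
  have hfirst : C.first ∉ S ∩ C.verts → Al.Nonempty :=
    fun h => ⟨C.first, mem_compOf_self ⟨C.first_mem, fun h' => h ⟨h', C.first_mem⟩⟩⟩
  have transfer : ∀ {x : ℕ}, x ≤ d → (Al.Nonempty → x + Al.ncard ≤ d) →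
      (Ar.ncard + if C.first ∈ Ar then x else 0) ≤ d → ∃ Y, IsMinCocSetOn H C'.verts d Y ∧
        (C'.first ∉ Y → x + (compOf H (C'.verts \ Y) C'.first).ncard ≤ d) ∧
        ((compOf H (C'.verts \ Y) C'.last).ncard +
          if C'.first ∈ compOf H (C'.verts \ Y) C'.last then x else 0) ≤
        Ar.ncard + if C.first ∈ Ar then x else 0 := by
    intro x hx hxl hxr
    have h1 := C.essence_le hd hx hmin (by rw [hA']; exact fun h => hxl (hfirst h))
    rw [hess x (by omega), hA'] at h1
    exact C'.exists_of_essence_le hd hxr h1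
  have hmeetA : (Al ∩ Ar).Nonempty → Al = Ar := compOf_eq_of_inter_nonempty
  have hfirstAr : C.first ∈ Ar → (Al ∩ Ar).Nonempty :=
    fun h => ⟨C.first, mem_compOf_self (compOf_subset _ _ _ h), h⟩
  -- the choice of a parameter `x` for the essence that accounts for everything attached at the left
  obtain ⟨x, hx, hxl, hxr, hXx, hdis, hjoin⟩ : ∃ x ≤ d, (Al.Nonempty → x + Al.ncard ≤ d) ∧
      (Ar.ncard + if C.first ∈ Ar then x else 0) + Xr.ncard ≤ d ∧ Xl.ncard ≤ x ∧
      ((Xl ∩ Xr).Nonempty → Xl = Xr ∧ 1 ≤ Xl.ncard ∧ C.first ∉ Ar ∧ x = Xl.ncard + Ar.ncard) ∧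
      (¬ (Xl ∩ Xr).Nonempty → x = Xl.ncard) := by
    by_cases hX : (Xl ∩ Xr).Nonempty
    · have hXeq : Xl = Xr := by
        obtain ⟨z, hz, hz'⟩ := hX
        rw [hXl, hXr, compsAt_eq_compOf hL hz, compsAt_eq_compOf hR hz']
      have hpos : 1 ≤ Xl.ncard :=
        (Set.ncard_pos).2 (hX.mono Set.inter_subset_left)
      have hnot : C.first ∉ Ar := by
        intro h
        have h1 := hthrough (mem_compOf_symm h)
        have h2 := hl ⟨_, (hfirstAr h).some_mem.1⟩
        omega
      refine ⟨Xl.ncard + Ar.ncard, by rw [hXeq]; exact hr, fun h => ?_, ?_, by omega,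
        fun _ => ⟨hXeq, hpos, hnot, rfl⟩, fun h => absurd hX h⟩
      · rcases Ar.eq_empty_or_nonempty with h' | h'
        · simpa [h'] using hl h
        · have hdisj : Disjoint Al Ar := by
            rw [Set.disjoint_iff_inter_eq_empty, ← Set.not_nonempty_iff_eq_empty]
            intro hm
            refine hnot (hmeetA hm ▸ mem_compOf_self ?_)
            obtain ⟨z, hz⟩ := h
            exact hz.1
          obtain ⟨z, hz, hz'⟩ := hX
          have hKeq : compOf G (Set.univ \ S) C.last = compOf G (Set.univ \ S) C.first :=
            compOf_eq_of_inter_nonempty ⟨z, hKr h' (Or.inl hz'), hKl h (Or.inl hz)⟩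
          have hsub : Xl ∪ (Al ∪ Ar) ⊆ compOf G (Set.univ \ S) C.first := by
            rw [← Set.union_assoc]
            exact Set.union_subset (hKl h) (hKeq ▸ Set.subset_union_right.trans (hKr h'))
          have h1 := (Set.ncard_le_ncard hsub).trans (hS.ncard_compOf_le _)
          rw [hAB hXlB (Set.union_subset hAlA hArA), Set.ncard_union_eq hdisj] at h1
          omega
      · rw [if_neg hnot]
        omega
    · refine ⟨Xl.ncard, hXld, hl, ?_, le_rfl, fun h => absurd h hX, fun _ => rfl⟩
      split_ifs with h
      · have hAeq := hmeetA (hfirstAr h)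
        have hne : Al.Nonempty := ⟨_, (hfirstAr h).some_mem.1⟩
        have hne' : Ar.Nonempty := ⟨_, h⟩
        have hKeq : compOf G (Set.univ \ S) C.last = compOf G (Set.univ \ S) C.first :=
          compOf_eq_of_inter_nonempty ⟨_, hKr hne' (Or.inr h), hKl hne (Or.inr (hAeq ▸ h))⟩
        have hsub : Xl ∪ Xr ∪ Ar ⊆ compOf G (Set.univ \ S) C.last := by
          rw [Set.union_assoc]
          exact Set.union_subset (hKeq ▸ Set.subset_union_left.trans (hKl hne)) (hKr hne')
        have h1 := (Set.ncard_le_ncard hsub).trans (hS.ncard_compOf_le _)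
        rw [hAB (Set.union_subset hXlB hXrB) hArA, Set.ncard_union_eq
          (Set.disjoint_iff_inter_eq_empty.2 (Set.not_nonempty_iff_eq_empty.1 hX))] at h1
        omega
      · omega
  obtain ⟨Y, hY, hYl, hYr⟩ := transfer hx hxl (by omega)
  refine ⟨Y, hY, ?_⟩
  set Wl := compOf H (C'.verts \ Y) C'.first with hWl
  set Wr := compOf H (C'.verts \ Y) C'.last with hWr
  have hWl' : Wl.Nonempty → x + Wl.ncard ≤ d := by
    rintro ⟨z, hz⟩
    exact hYl hz.1.2
  refine ⟨?_, by omega, ?_⟩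
  · rcases Wl.eq_empty_or_nonempty with h | h
    · simpa [h] using hXld
    · have := hWl' h
      omega
  · intro hj
    by_cases hX : (Xl ∩ Xr).Nonempty
    · obtain ⟨hXeq, hpos, hnot, hxeq⟩ := hdis hX
      rw [← hXeq, Set.union_self]
      rw [if_neg hnot] at hYr hxr
      have hu := Set.ncard_union_le Wl Wr
      rcases Wl.eq_empty_or_nonempty with h | h
      · rw [h, Set.ncard_empty] at hu
        rw [h]
        omega
      · have := hWl' h
        omega
    · have hW := hj.resolve_left hX
      have hWeq : Wl = Wr := compOf_eq_of_inter_nonempty hW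
      have hmem : C'.first ∈ Wr := hWeq ▸ mem_compOf_self hW.some_mem.1.1
      rw [if_pos hmem] at hYr
      have hu := Set.ncard_union_le Xl Xr
      have := hjoin hX
      rw [hWeq, Set.union_self]
      omega

/-- Let `(G, d, k, M)` be such that `G − M` is a caterpillar forest,
let `A` be (the vertex set of) a connected merged subgraph `P` of `G − M` (with induced
spine caterpillar structure `CA`, lying in the component `𝔉.comp c` of `G − M`), let `γ`
be the essence of `P`, let `P'` (the caterpillar `C'` on `W`, whose solution-tight
packing contains all its vertices) be an arbitrary caterpillar with essence `γ`, and
let `G'` be obtained from `G` by replacing `P` with `P'` (deleting `A`, adding `C'`,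
joining the rightmost spine vertex of the component left of `A` — if it exists — to the
leftmost spine vertex of `C'`, and the leftmost spine vertex right of `A` — if it
exists — to the rightmost spine vertex of `C'`). If `G` has a `d`-coc set of size at
most `k`, then `G'` has a `d`-coc set of size at most `k' = k − opt(P) + opt(P')`. -/
theorem stmt15 {V W : Type} [Fintype V] [Fintype W]
    (G : SimpleGraph V) (M : Set V) (d k : ℕ) (hd : 1 ≤ d)
    (𝔉 : SpinedCatForest G Mᶜ)
    (P : Finset (Set V)) (hP : IsForestSTP G d 𝔉 P)
    (A : Set V) (hmerged : ∃ P' ⊆ P, A = ⋃₀ (↑P' : Set (Set V)))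
    (hconn : (G.induce A).Connected)
    (c : Fin 𝔉.numComps) (hAc : A ⊆ (𝔉.comp c).verts)
    (CA : SubCaterpillar G) (hCA : CA.verts = A)
    (hCAsp : ∀ i : Fin CA.n, ∃ j : Fin (𝔉.comp c).n, CA.spine i = (𝔉.comp c).spine j)
    (hCAord : ∀ (i i' : Fin CA.n) (j j' : Fin (𝔉.comp c).n),
      CA.spine i = (𝔉.comp c).spine j → CA.spine i' = (𝔉.comp c).spine j' →
      ((i : ℕ) ≤ (i' : ℕ) ↔ (j : ℕ) ≤ (j' : ℕ)))
    (hCAcover : Set.range CA.spine = Set.range (𝔉.comp c).spine ∩ A)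
    (H : SimpleGraph W) (C' : SubCaterpillar H) (hC'v : C'.verts = Set.univ)
    (hC'full : ∃ Q : Finset (Set W), IsSTP H d C' Q ∧ ⋃₀ (↑Q : Set (Set W)) = C'.verts)
    (hess : ∀ x ≤ d + 1, CA.essence d x = C'.essence d x)
    (G' : SimpleGraph (↥(Aᶜ) ⊕ W))
    (hG'1 : ∀ u u' : ↥(Aᶜ), G'.Adj (Sum.inl u) (Sum.inl u') ↔ G.Adj (u : V) (u' : V))
    (hG'2 : ∀ w w' : W, G'.Adj (Sum.inr w) (Sum.inr w') ↔ H.Adj w w')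
    (hG'3 : ∀ (u : ↥(Aᶜ)) (w : W), G'.Adj (Sum.inl u) (Sum.inr w) ↔
      ((∃ i : Fin (𝔉.comp c).n, (𝔉.comp c).spine i = (u : V) ∧
          (∀ a ∈ A, (i : ℕ) < (𝔉.comp c).pos a) ∧
          (∀ j : Fin (𝔉.comp c).n,
            (∀ a ∈ A, (j : ℕ) < (𝔉.comp c).pos a) → (j : ℕ) ≤ (i : ℕ))) ∧
        w = C'.spine ⟨0, C'.npos⟩) ∨
      ((∃ i : Fin (𝔉.comp c).n, (𝔉.comp c).spine i = (u : V) ∧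
          (∀ a ∈ A, (𝔉.comp c).pos a < (i : ℕ)) ∧
          (∀ j : Fin (𝔉.comp c).n,
            (∀ a ∈ A, (𝔉.comp c).pos a < (j : ℕ)) → (i : ℕ) ≤ (j : ℕ))) ∧
        w = C'.spine ⟨C'.n - 1, Nat.sub_lt C'.npos Nat.one_pos⟩)) :
    (∃ S : Set V, IsCocSetOn G Set.univ d S ∧ S.ncard ≤ k) →
    ∃ S' : Set (↥(Aᶜ) ⊕ W), IsCocSetOn G' Set.univ d S' ∧
      S'.ncard + cocOptOn G A d ≤ k + cocOptOn H Set.univ d := by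
  subst hCA
  rintro ⟨S, hS, hSk⟩
  set C := 𝔉.comp c
  obtain ⟨Q, hQ, hPQ⟩ := hP
  obtain ⟨P', hP'P, hAP'⟩ := hmerged
  have hP'Q : P' ⊆ Q c := by
    intro X hX
    have hXP : X ∈ ⋃ c, (↑(Q c) : Set (Set V)) := hPQ ▸ hP'P hX
    obtain ⟨c', hXc'⟩ := Set.mem_iUnion.1 hXP
    obtain ⟨hsub, -, hXconn⟩ := (hQ c').1 X hXc'
    obtain ⟨v, hv⟩ := hXconn.nonempty
    have hvA : v ∈ CA.verts := hAP' ▸ Set.mem_sUnion_of_mem hv hX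
    by_cases h : c' = c
    · exact h ▸ hXc'
    · exact absurd (hAc hvA) (Set.disjoint_left.1 (𝔉.disj c' c h) (hsub hv))
  have hpack : P'.card * (d + 1) ≤ CA.verts.ncard := by
    rw [hAP']
    exact card_mul_le_ncard_sUnion P' ((hQ c).2.1.mono (Finset.coe_subset.2 hP'Q))
      fun X hX => ((hQ c).1 X (hP'Q hX)).2.1
  have hopt : cocOptOn G CA.verts d ≤ P'.card := by
    obtain ⟨Y, hYsub, hY, hYcard, -⟩ := (hQ c).exists_coc_transversal hd hP'Q
    rw [← hAP'] at hY hYsub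
    exact (cocOptOn_le hYsub hY).trans hYcard
  have hP'pos : 1 ≤ P'.card := by
    rw [Nat.one_le_iff_ne_zero, Finset.card_ne_zero]
    have h := CA.first_mem
    rw [hAP'] at h
    obtain ⟨X, hX, -⟩ := h
    exact ⟨X, hX⟩
  have hSA : (S \ CA.verts).ncard + (S ∩ CA.verts).ncard = S.ncard :=
    (add_comm _ _).trans (Set.ncard_inter_add_ncard_sdiff_eq_ncard S CA.verts)
  have hSopt : cocOptOn G CA.verts d ≤ (S ∩ CA.verts).ncard :=
    cocOptOn_le Set.inter_subset_right
      (hS.mono fun v hv => ⟨trivial, fun h => hv.2 ⟨h, hv.1⟩⟩)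
  have hBS : CA.vertsᶜ \ S ⊆ Set.univ \ S := fun v hv => ⟨trivial, hv.2⟩
  have hBd : ∀ v, (compOf G (CA.vertsᶜ \ S) v).ncard ≤ d := fun v =>
    (Set.ncard_le_ncard (compOf_mono hBS v)).trans (hS.ncard_compOf_le v)
  set L : V → Prop := fun u => ∃ i : Fin C.n, C.spine i = u ∧
    (∀ a ∈ CA.verts, (i : ℕ) < C.pos a) ∧
    ∀ j : Fin C.n, (∀ a ∈ CA.verts, (j : ℕ) < C.pos a) → (j : ℕ) ≤ (i : ℕ)
  set R : V → Prop := fun u => ∃ i : Fin C.n, C.spine i = u ∧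
    (∀ a ∈ CA.verts, C.pos a < (i : ℕ)) ∧
    ∀ j : Fin C.n, (∀ a ∈ CA.verts, C.pos a < (j : ℕ)) → (i : ℕ) ≤ (j : ℕ)
  have hL : ∀ u u', L u → L u' → u = u' := by
    rintro _ _ ⟨i, rfl, hi, hi'⟩ ⟨j, rfl, hj, hj'⟩
    rw [Fin.ext (le_antisymm (hj' i hi) (hi' j hj))]
  have hR : ∀ u u', R u → R u' → u = u' := by
    rintro _ _ ⟨i, rfl, hi, hi'⟩ ⟨j, rfl, hj, hj'⟩
    rw [Fin.ext (le_antisymm (hi' j hj) (hj' i hi))]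
  have hLadj : ∀ u, L u → G.Adj u CA.first := by
    rintro _ ⟨i, rfl, hi, hi'⟩
    obtain ⟨j, hj⟩ := hCAsp ⟨0, CA.npos⟩
    have hfirst : CA.first = C.spine j := hj
    have hij : (i : ℕ) < j := by simpa [hfirst, C.pos_spine] using hi _ CA.first_mem
    have hle : (j : ℕ) - 1 ≤ i := by
      refine hi' ⟨j - 1, by omega⟩ fun a ha => ?_
      obtain ⟨i', j', hij', hpos⟩ := C.exists_spine_eq_pos hAc hCAcover ha
      have := (hCAord ⟨0, CA.npos⟩ i' j j' hj hij').1 (Nat.zero_le _)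
      rw [hpos]
      simp only
      omega
    have hji : j = ⟨(i : ℕ) + 1, by omega⟩ := Fin.ext (by simp only; omega)
    rw [hfirst, hji]
    exact C.spineAdj i _
  have hRadj : ∀ u, R u → G.Adj u CA.last := by
    rintro _ ⟨i, rfl, hi, hi'⟩
    obtain ⟨j, hj⟩ := hCAsp ⟨CA.n - 1, Nat.sub_lt CA.npos Nat.one_pos⟩
    have hlast : CA.last = C.spine j := hj
    have hij : (j : ℕ) < i := by simpa [hlast, C.pos_spine] using hi _ CA.last_mem
    have hle : (i : ℕ) ≤ j + 1 := by
      refine hi' ⟨j + 1, by omega⟩ fun a ha => ?_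
      obtain ⟨i', j', hij', hpos⟩ := C.exists_spine_eq_pos hAc hCAcover ha
      have := (hCAord i' _ j' j hij' hj).1 (Nat.le_sub_one_of_lt i'.2)
      rw [hpos]
      simp only
      omega
    have hji : i = ⟨(j : ℕ) + 1, by omega⟩ := Fin.ext (by simp only; omega)
    rw [hlast, hji]
    exact (C.spineAdj j _).symm
  suffices hY : ∃ Y, IsCocSetOn H Set.univ d Y ∧
      Y.ncard + cocOptOn G CA.verts d ≤ (S ∩ CA.verts).ncard + cocOptOn H Set.univ d ∧
      (compsAt G (CA.vertsᶜ \ S) L).ncard + (compOf H (Set.univ \ Y) C'.first).ncard ≤ d ∧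
      (compsAt G (CA.vertsᶜ \ S) R).ncard + (compOf H (Set.univ \ Y) C'.last).ncard ≤ d ∧
      ((compsAt G (CA.vertsᶜ \ S) L ∩ compsAt G (CA.vertsᶜ \ S) R).Nonempty ∨
          (compOf H (Set.univ \ Y) C'.first ∩ compOf H (Set.univ \ Y) C'.last).Nonempty →
        (compsAt G (CA.vertsᶜ \ S) L ∪ compsAt G (CA.vertsᶜ \ S) R).ncard +
          (compOf H (Set.univ \ Y) C'.first ∪ compOf H (Set.univ \ Y) C'.last).ncard ≤ d) by
    obtain ⟨Y, hYcoc, hYcard, hl, hr, hlr⟩ := hY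
    refine ⟨sumSet CA.vertsᶜ S Y, isCocSetOn_glue (fun u u' => (hG'1 u u').1)
      (fun w w' => (hG'2 w w').1) (fun u w => (hG'3 u w).1) hBd hYcoc hl hr hlr, ?_⟩
    have hsub : sumSet CA.vertsᶜ S Y ⊆ sumSet CA.vertsᶜ (S \ CA.verts) Y := by
      rintro (u | w) h
      · exact ⟨h, u.2⟩
      · exact h
    have hle := Set.ncard_le_ncard hsub
    rw [ncard_sumSet (show S \ CA.verts ⊆ CA.vertsᶜ from fun v hv => hv.2)] at hle
    omega
  rcases hSopt.eq_or_lt with hcard | hlt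
  · have hthrough : CA.last ∈ compOf G (CA.verts \ S) CA.first →
        d ≤ (compOf G (CA.verts \ S) CA.first).ncard := by
      intro h
      have h1 := Set.ncard_le_ncard (CA.sdiff_subset_compOf_first h)
      have h2 := Set.ncard_inter_add_ncard_sdiff_eq_ncard CA.verts S
      rw [Set.inter_comm, ← hcard] at h2
      have h3 : d ≤ P'.card * d := Nat.le_mul_of_pos_left d hP'pos
      rw [mul_add, mul_one] at hpack
      omega
    obtain ⟨Y, hY, hl, hr, hlr⟩ :=
      exists_minCoc_glue hd CA C' hess hL hR hLadj hRadj hS hcard.symm hthrough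
    rw [hC'v] at hY hl hr hlr
    exact ⟨Y, hY.2.1, by rw [hY.2.2, hcard, add_comm], hl, hr, hlr⟩
  · obtain ⟨Q', hQ', hQ'full⟩ := hC'full
    obtain ⟨Y, -, hY, hYcard, hYlast⟩ := hQ'.exists_coc_transversal hd subset_rfl
    rw [hQ'full] at hY hYlast
    rw [hQ'.2.2.1, hC'v] at hYcard
    rw [hC'v] at hY
    have hfirst : C'.first ∉ Set.univ \ insert C'.first Y :=
      fun h => h.2 (Set.mem_insert _ _)
    have hlast : C'.last ∉ Set.univ \ insert C'.first Y :=
      fun h => h.2 (Set.mem_insert_of_mem _ (hYlast C'.last_mem))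
    refine ⟨insert C'.first Y,
      hY.mono (Set.sdiff_subset_sdiff_right (Set.subset_insert _ _)), ?_, ?_⟩
    · have := Set.ncard_insert_le C'.first Y
      omega
    · rw [compOf_eq_empty hfirst, compOf_eq_empty hlast]
      simp only [Set.ncard_empty, add_zero, Set.union_empty, Set.inter_empty,
        Set.not_nonempty_empty, or_false]
      refine ⟨ncard_compsAt_le hL hBd, ncard_compsAt_le hR hBd, ?_⟩
      rintro ⟨v, hv, hv'⟩
      rw [compsAt_eq_compOf hL hv, compsAt_eq_compOf hR hv', Set.union_self]
      exact hBd v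

end CocPaper
end

section
/- Let G be a finite simple graph, M ⊆ V(G), and C a connected subgraph of G − M that is a caterpillar with fixed spine order. Let P be a packing of pairwise vertex-disjoint connected subgraphs of C such that every graph of P contains at least one spine vertex of C. Then for any integers c₁, c₂ ≥ 1 there exists a subfamily P̃ ⊆ P with |P̃| ≥ |P| − |M|·(c₁ + c₂) such that for each P ∈ P̃ and each v ∈ N(P) ∩ M, vertex v has at least c₁ neighbors lying in graphs of P that are left of P and at least c₂ neighbors lying in graphs of P that are right of P. -/
namespace CocPaper

open SimpleGraph

variable {V : Type} {W : Type}

theorem SubCaterpillar.eq_of_adj_of_notMem_spine {G : SimpleGraph V} (C : SubCaterpillar G)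
    {u x y : V} (hu : u ∈ C.verts) (hus : u ∉ Set.range C.spine) (hx : x ∈ C.verts)
    (hux : G.Adj u x) (hy : y ∈ C.verts) (huy : G.Adj u y) : x = y := by
  obtain ⟨z, hz⟩ := Set.ncard_eq_one.1 (C.pendant u hu hus)
  have h1 : x ∈ ({z} : Set V) := hz ▸ ⟨hx, hux⟩
  have h2 : y ∈ ({z} : Set V) := hz ▸ ⟨hy, huy⟩
  exact (Set.mem_singleton_iff.1 h1).trans (Set.mem_singleton_iff.1 h2).symm

/-- A pendant in a connected subgraph meeting the spine has its parent in that subgraph. -/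
theorem SubCaterpillar.exists_adj_spine_mem {G : SimpleGraph V} (C : SubCaterpillar G)
    {A : Set V} (hA : A ⊆ C.verts) (hconn : (G.induce A).Connected)
    (hs : ∃ i, C.spine i ∈ A) {u : V} (hu : u ∈ A) (hus : u ∉ Set.range C.spine) :
    ∃ j, C.spine j ∈ A ∧ G.Adj u (C.spine j) := by
  obtain ⟨i, hi⟩ := hs
  obtain ⟨p, hp⟩ := (hconn.preconnected ⟨u, hu⟩ ⟨C.spine i, hi⟩).exists_isPath
  cases p with
  | nil => exact absurd ⟨i, rfl⟩ hus
  | @cons _ w _ huw q =>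
    by_cases hw : (w : V) ∈ Set.range C.spine
    · obtain ⟨j, hj⟩ := hw
      exact ⟨j, hj ▸ w.2, hj ▸ huw⟩
    · cases q with
      | nil => exact absurd ⟨i, rfl⟩ hw
      | @cons _ x _ hwx r =>
        have hxu : (x : V) = u := C.eq_of_adj_of_notMem_spine (hA w.2) hw (hA x.2) hwx
          (hA hu) huw.symm
        have hx : x = ⟨u, hu⟩ := Subtype.ext hxu
        subst hx
        simp [Walk.cons_isPath_iff] at hp

theorem SubCaterpillar.spine_pos_mem {G : SimpleGraph V} (C : SubCaterpillar G)
    {A : Set V} (hA : A ⊆ C.verts) (hconn : (G.induce A).Connected)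
    (hs : ∃ i, C.spine i ∈ A) {u : V} (hu : u ∈ A) :
    ∃ h : C.pos u < C.n, C.spine ⟨C.pos u, h⟩ ∈ A := by
  have hmem : C.pos u ∈ {i : ℕ | ∃ h : i < C.n,
      C.spine ⟨i, h⟩ = u ∨ (u ∉ Set.range C.spine ∧ G.Adj u (C.spine ⟨i, h⟩))} := by
    refine Nat.sInf_mem ?_
    by_cases hus : u ∈ Set.range C.spine
    · obtain ⟨j, hj⟩ := hus
      exact ⟨j, j.2, Or.inl hj⟩
    · obtain ⟨j, -, hj⟩ := C.exists_adj_spine_mem hA hconn hs hu hus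
      exact ⟨j, j.2, Or.inr ⟨hus, hj⟩⟩
  obtain ⟨h, h' | ⟨hus, hadj⟩⟩ := hmem
  · exact ⟨h, (congrArg (· ∈ A) h').mpr hu⟩
  · obtain ⟨j, hjA, hj⟩ := C.exists_adj_spine_mem hA hconn hs hu hus
    exact ⟨h, C.eq_of_adj_of_notMem_spine (hA hu) hus (hA hjA) hj (C.spineMem _) hadj ▸ hjA⟩

/-- At most `c` elements of a linearly ordered finite family have fewer than `c` predecessors. -/
theorem card_filter_card_lt_le {α β : Type*} [LinearOrder β] (Q : Finset α) (f : α → β)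
    (hf : Set.InjOn f Q) (c : ℕ) :
    (Q.filter fun a => (Q.filter fun b => f b < f a).card < c).card ≤ c := by
  have hlt : ∀ a ∈ Q, ∀ b ∈ Q, f a < f b →
      (Q.filter fun x => f x < f a).card < (Q.filter fun x => f x < f b).card := by
    intro a ha b _ hab
    refine Finset.card_lt_card (Finset.ssubset_iff_of_subset ?_ |>.2 ⟨a, ?_, ?_⟩)
    · intro x hx
      rw [Finset.mem_filter] at hx ⊢
      exact ⟨hx.1, hx.2.trans hab⟩
    · simp [ha, hab]
    · simp
  refine (Finset.card_le_card_of_injOn (t := Finset.range c)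
    (fun a => (Q.filter fun b => f b < f a).card) ?_ ?_).trans_eq (Finset.card_range c)
  · intro a ha
    simpa using (Finset.mem_filter.1 ha).2
  · intro a ha b hb hab
    have haQ := (Finset.mem_filter.1 ha).1
    have hbQ := (Finset.mem_filter.1 hb).1
    rcases lt_trichotomy (f a) (f b) with h | h | h
    · exact absurd hab (hlt a haQ b hbQ h).ne
    · exact hf haQ hbQ h
    · exact absurd hab (hlt b hbQ a haQ h).ne'

theorem card_le_ncard_of_disjoint_of_meets [Finite V] {Q : Finset (Set V)} {S : Set V}
    (hdisj : (↑Q : Set (Set V)).Pairwise fun A B => Disjoint A B)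
    (hS : ∀ B ∈ Q, ∃ w ∈ B, w ∈ S) : Q.card ≤ S.ncard := by
  rcases Q.eq_empty_or_nonempty with rfl | ⟨B₀, hB₀⟩
  · simp
  have : Nonempty V := ⟨(hS B₀ hB₀).choose⟩
  choose! g hgB hgS using hS
  rw [← Set.ncard_coe_finset]
  refine Set.ncard_le_ncard_of_injOn g hgS ?_ S.toFinite
  intro A hA B hB hAB
  by_contra hne
  exact Set.disjoint_left.1 (hdisj hA hB hne) (hgB A hA) (hAB ▸ hgB B hB)

/-- Let `G` be a finite simple graph, `M ⊆ V(G)`, and `C` a connected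
subgraph of `G − M` that is a caterpillar with fixed spine order. Let `P` be a packing
of pairwise vertex-disjoint connected subgraphs of `C`, each containing a spine vertex
of `C`. Then for any `c₁, c₂ ≥ 1` there is `P̃ ⊆ P` with `|P̃| ≥ |P| − |M|·(c₁+c₂)` such
that for each `A ∈ P̃` and each `v ∈ N(A) ∩ M`, `v` has at least `c₁` neighbors in graphs
of `P` left of `A` and at least `c₂` neighbors in graphs of `P` right of `A`. -/
theorem stmt16 {V : Type} [Fintype V] (G : SimpleGraph V) (M : Set V)
    (C : SubCaterpillar G) (hCM : Disjoint C.verts M)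
    (P : Finset (Set V))
    (hmem : ∀ A ∈ P, A ⊆ C.verts ∧ (G.induce A).Connected ∧ ∃ i : Fin C.n, C.spine i ∈ A)
    (hdisj : (↑P : Set (Set V)).Pairwise fun A B => Disjoint A B)
    (c₁ c₂ : ℕ) (hc₁ : 1 ≤ c₁) (hc₂ : 1 ≤ c₂) :
    ∃ Pt ⊆ P, P.card ≤ Pt.card + M.ncard * (c₁ + c₂) ∧
      ∀ A ∈ Pt, ∀ v ∈ M, (∃ a ∈ A, G.Adj v a) →
        c₁ ≤ {w : V | G.Adj v w ∧ ∃ B ∈ P, w ∈ B ∧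
                ∃ b ∈ B, ∀ u ∈ A, C.pos b < C.pos u}.ncard ∧
        c₂ ≤ {w : V | G.Adj v w ∧ ∃ B ∈ P, w ∈ B ∧
                ∃ b ∈ B, ∀ u ∈ A, C.pos u < C.pos b}.ncard := by
  classical
  have : Nonempty V := ⟨C.spine ⟨0, C.npos⟩⟩
  have hne : ∀ A ∈ P, A.Nonempty := fun A hA => (hmem A hA).2.2.imp' C.spine fun _ h => h
  have hfirst : ∀ A ∈ P, ∃ a ∈ A, ∀ u ∈ A, C.pos a ≤ C.pos u := fun A hA =>
    A.toFinite.exists_minimalFor C.pos A (hne A hA) |>.imp fun a ha =>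
      ⟨ha.1, fun u hu => (le_total _ _).elim id fun h => ha.2 hu h⟩
  have hlast : ∀ A ∈ P, ∃ a ∈ A, ∀ u ∈ A, C.pos u ≤ C.pos a := fun A hA =>
    A.toFinite.exists_maximalFor C.pos A (hne A hA) |>.imp fun a ha =>
      ⟨ha.1, fun u hu => (le_total _ _).elim id fun h => ha.2 hu h⟩
  choose! l hlA hl using hfirst
  choose! r hrA hr using hlast
  have hinj : ∀ A ∈ P, ∀ B ∈ P, ∀ a ∈ A, ∀ b ∈ B, C.pos a = C.pos b → A = B := by
    intro A hA B hB a ha b hb hab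
    by_contra h
    obtain ⟨_, h1⟩ := C.spine_pos_mem (hmem A hA).1 (hmem A hA).2.1 (hmem A hA).2.2 ha
    obtain ⟨_, h2⟩ := C.spine_pos_mem (hmem B hB).1 (hmem B hB).2.1 (hmem B hB).2.2 hb
    simp only [hab] at h1
    exact Set.disjoint_left.1 (hdisj hA hB h) h1 h2
  let Q : V → Finset (Set V) := fun v => P.filter fun A => ∃ a ∈ A, G.Adj v a
  have hQP : ∀ v, Q v ⊆ P := fun v => Finset.filter_subset _ _
  let fl : Set V → ℕ := fun A => C.pos (l A)
  let fr : Set V → ℕᵒᵈ := fun A => OrderDual.toDual (C.pos (r A))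
  let L : V → Finset (Set V) := fun v =>
    (Q v).filter fun A => ((Q v).filter fun B => fl B < fl A).card < c₁
  let R : V → Finset (Set V) := fun v =>
    (Q v).filter fun A => ((Q v).filter fun B => fr B < fr A).card < c₂
  have hL : ∀ v, (L v).card ≤ c₁ := fun v => card_filter_card_lt_le (Q v) fl
    (fun A hA B hB h => hinj A (hQP v hA) B (hQP v hB) _ (hlA A (hQP v hA)) _
      (hlA B (hQP v hB)) h) c₁
  have hR : ∀ v, (R v).card ≤ c₂ := fun v => card_filter_card_lt_le (Q v) fr
    (fun A hA B hB h => hinj A (hQP v hA) B (hQP v hB) _ (hrA A (hQP v hA)) _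
      (hrA B (hQP v hB)) h) c₂
  let D : Finset (Set V) := M.toFinset.biUnion fun v => L v ∪ R v
  have hD : D.card ≤ M.ncard * (c₁ + c₂) := by
    rw [Set.ncard_eq_toFinset_card']
    exact Finset.card_biUnion_le_card_mul _ _ _ fun v _ =>
      (Finset.card_union_le _ _).trans (add_le_add (hL v) (hR v))
  refine ⟨P \ D, Finset.sdiff_subset, ?_, ?_⟩
  · have := Finset.le_card_sdiff D P
    omega
  intro A hA v hv hvA
  obtain ⟨hAP, hAD⟩ := Finset.mem_sdiff.1 hA
  have hAQ : A ∈ Q v := Finset.mem_filter.2 ⟨hAP, hvA⟩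
  have hAv : A ∉ L v ∪ R v := fun h =>
    hAD (Finset.mem_biUnion.2 ⟨v, Set.mem_toFinset.2 hv, h⟩)
  rw [Finset.mem_union, not_or] at hAv
  have hsub : ∀ p : Set V → Prop, [DecidablePred p] →
      (↑((Q v).filter p) : Set (Set V)).Pairwise fun A B => Disjoint A B := fun p _ =>
    hdisj.mono fun B hB => hQP v (Finset.mem_filter.1 hB).1
  constructor
  · have hc : c₁ ≤ ((Q v).filter fun B => fl B < fl A).card :=
      not_lt.1 fun h => hAv.1 (Finset.mem_filter.2 ⟨hAQ, h⟩)
    refine hc.trans (card_le_ncard_of_disjoint_of_meets (hsub _) fun B hB => ?_)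
    obtain ⟨hBQ, hBA⟩ := Finset.mem_filter.1 hB
    obtain ⟨hBP, w, hwB, hvw⟩ := Finset.mem_filter.1 hBQ
    exact ⟨w, hwB, hvw, B, hBP, hwB, l B, hlA B hBP, fun u hu => hBA.trans_le (hl A hAP u hu)⟩
  · have hc : c₂ ≤ ((Q v).filter fun B => fr B < fr A).card :=
      not_lt.1 fun h => hAv.2 (Finset.mem_filter.2 ⟨hAQ, h⟩)
    refine hc.trans (card_le_ncard_of_disjoint_of_meets (hsub _) fun B hB => ?_)
    obtain ⟨hBQ, hBA⟩ := Finset.mem_filter.1 hB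
    obtain ⟨hBP, w, hwB, hvw⟩ := Finset.mem_filter.1 hBQ
    exact ⟨w, hwB, hvw, B, hBP, hwB, r B, hrA B hBP,
      fun u hu => (hr A hAP u hu).trans_lt (OrderDual.toDual_lt_toDual.1 hBA)⟩

end CocPaper
end

section
/- Let G be a finite simple graph, d ≥ 1 an integer, M ⊆ V(G) a set such that G − M is a caterpillar forest, and let c_p = (d³+1)·(2d·|M| + 1). Let C be a connected component of G − M, let P_{c_p} be the c_p-merged packing of C, and let P_{d³+1} be the (d³+1)-merged packing of C. Then for each graph G₁ in P_{c_p} there exists a subgraph G₂ of G₁ such that: (1) G₂ ∈ P_{d³+1}; (2) each v ∈ N(G₂) ∩ M has at least d neighbors in G₁ that are left of G₂; and (3) each v ∈ N(G₂) ∩ M has at least d neighbors in G₁ that are right of G₂. -/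
namespace CocPaper

open SimpleGraph

variable {V : Type} {W : Type}

/-- In a finite set `T` of naturals, at most `d` elements have fewer than `d` elements of `T`
below them. -/
lemma card_filter_card_filter_lt_le (T : Finset ℕ) (d : ℕ) :
    (T.filter fun k => (T.filter fun j => j < k).card < d).card ≤ d := by
  have h := Finset.card_le_card_of_injOn
    (s := T.filter fun k => (T.filter fun j => j < k).card < d) (t := Finset.range d)
    (fun k => (T.filter fun j => j < k).card)
    (by intro k hk; simpa using (Finset.mem_filter.1 hk).2)
    (by
      have key : ∀ a ∈ T, ∀ b, a < b →
          (T.filter fun j => j < a).card < (T.filter fun j => j < b).card := by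
        intro a ha b hab
        refine Finset.card_lt_card (Finset.ssubset_iff_of_subset ?_ |>.2 ⟨a, ?_, ?_⟩)
        · intro j hj
          simp only [Finset.mem_filter] at hj ⊢
          exact ⟨hj.1, hj.2.trans hab⟩
        · simp [ha, hab]
        · simp
      intro a ha b hb hab
      rcases lt_trichotomy a b with h | h | h
      · exact absurd hab (key a (Finset.mem_filter.1 ha).1 b h).ne
      · exact h
      · exact absurd hab (key b (Finset.mem_filter.1 hb).1 a h).ne')
  simpa using h

/-- In a finite set `T` of naturals, at most `d` elements have fewer than `d` elements of `T`
above them. -/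
lemma card_filter_card_filter_gt_le (T : Finset ℕ) (d : ℕ) :
    (T.filter fun k => (T.filter fun j => k < j).card < d).card ≤ d := by
  have h := Finset.card_le_card_of_injOn
    (s := T.filter fun k => (T.filter fun j => k < j).card < d) (t := Finset.range d)
    (fun k => (T.filter fun j => k < j).card)
    (by intro k hk; simpa using (Finset.mem_filter.1 hk).2)
    (by
      have key : ∀ a, ∀ b ∈ T, a < b →
          (T.filter fun j => b < j).card < (T.filter fun j => a < j).card := by
        intro a b hb hab
        refine Finset.card_lt_card (Finset.ssubset_iff_of_subset ?_ |>.2 ⟨b, ?_, ?_⟩)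
        · intro j hj
          simp only [Finset.mem_filter] at hj ⊢
          exact ⟨hj.1, hab.trans hj.2⟩
        · simp [hb, hab]
        · simp
      intro a ha b hb hab
      rcases lt_trichotomy a b with h | h | h
      · exact absurd hab (key a b (Finset.mem_filter.1 hb).1 h).ne'
      · exact h
      · exact absurd hab (key b a (Finset.mem_filter.1 ha).1 h).ne)
  simpa using h

/-- Given a family of finite sets of naturals indexed by `M`, some `k ≤ 2 d |M|` has, in every
member containing it, at least `d` elements below and at least `d` elements above. -/
lemma exists_lt_forall_le_card_filter (M : Finset V) (T : V → Finset ℕ) (d : ℕ) :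
    ∃ k < 2 * d * M.card + 1, ∀ v ∈ M, k ∈ T v →
      d ≤ ((T v).filter fun j => j < k).card ∧ d ≤ ((T v).filter fun j => k < j).card := by
  classical
  let B : V → Finset ℕ := fun v =>
    ((T v).filter fun k => ((T v).filter fun j => j < k).card < d) ∪
      ((T v).filter fun k => ((T v).filter fun j => k < j).card < d)
  have hB : ∀ v ∈ M, (B v).card ≤ 2 * d := fun v _ => by
    have h₁ := card_filter_card_filter_lt_le (T v) d
    have h₂ := card_filter_card_filter_gt_le (T v) d
    exact (Finset.card_union_le _ _).trans (by omega)
  have hU : (M.biUnion B).card < (Finset.range (2 * d * M.card + 1)).card := by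
    have := Finset.card_biUnion_le_card_mul M B (2 * d) hB
    rw [Finset.card_range]
    linarith [mul_comm M.card (2 * d)]
  obtain ⟨k, hk, hkB⟩ := Finset.exists_mem_notMem_of_card_lt_card hU
  refine ⟨k, Finset.mem_range.1 hk, fun v hv hkv => ?_⟩
  have hkv' : k ∉ B v := fun h => hkB (Finset.mem_biUnion.2 ⟨v, hv, h⟩)
  simp only [B, Finset.mem_union, Finset.mem_filter, hkv, true_and, not_or, not_lt] at hkv'
  exact hkv'

/-- A set meeting each of the pairwise disjoint sets `p k`, `k ∈ S`, has at least `|S|`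
elements. -/
lemma card_le_ncard_of_forall_exists [Finite V] {S : Finset ℕ} {X : Set V} (p : ℕ → Set V)
    (hp : ∀ a b, a < b → Disjoint (p a) (p b)) (h : ∀ k ∈ S, ∃ w ∈ p k, w ∈ X) :
    S.card ≤ X.ncard := by
  rcases S.eq_empty_or_nonempty with rfl | ⟨k, hk⟩
  · simp
  have : Nonempty V := ⟨(h k hk).choose⟩
  choose! f hf hfX using h
  rw [← Set.ncard_coe_finset]
  refine Set.ncard_le_ncard_of_injOn f hfX ?_ (Set.toFinite X)
  intro a ha b hb hab
  rcases lt_trichotomy a b with h | h | h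
  · exact (Set.disjoint_left.1 (hp a b h) (hf a ha) (hab ▸ hf b hb)).elim
  · exact h
  · exact (Set.disjoint_left.1 (hp b a h) (hf b hb) (hab ▸ hf a ha)).elim

lemma mem_mergedPiece {t : ℕ} {H : Fin t → Set V} {α i : ℕ} {v : V} :
    v ∈ mergedPiece H α i ↔ ∃ j : Fin t, (i * α ≤ j ∧ (j : ℕ) < i * α + α) ∧ v ∈ H j := by
  simp [mergedPiece]

lemma mergedPiece_subset_mergedPiece_mul {t : ℕ} (H : Fin t → Set V) (α : ℕ) {K i k : ℕ}
    (hk : k < K) : mergedPiece H α (i * K + k) ⊆ mergedPiece H (α * K) i := by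
  intro v hv
  obtain ⟨j, ⟨h₁, h₂⟩, hj⟩ := mem_mergedPiece.1 hv
  have h₃ : (k + 1) * α ≤ K * α := Nat.mul_le_mul_right α hk
  exact mem_mergedPiece.2 ⟨j, ⟨by nlinarith, by nlinarith⟩, hj⟩

/-- Merged pieces of an ordered solution-tight packing are ordered left to right. -/
lemma IsOrderedSTP.pos_lt_pos {G : SimpleGraph V} {d t : ℕ} {C : SubCaterpillar G}
    {H : Fin t → Set V} (hH : IsOrderedSTP G d C H) {α a b : ℕ} (hab : a < b) {v w : V}
    (hv : v ∈ mergedPiece H α a) (hw : w ∈ mergedPiece H α b) : C.pos v < C.pos w := by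
  obtain ⟨j, ⟨_, h₂⟩, hj⟩ := mem_mergedPiece.1 hv
  obtain ⟨j', ⟨h₁, _⟩, hj'⟩ := mem_mergedPiece.1 hw
  have h₃ : (a + 1) * α ≤ b * α := Nat.mul_le_mul_right α hab
  exact hH.2.2 j j' (Fin.lt_def.2 (by nlinarith)) v hj w hj'

/-- Let `G` be a finite simple graph, `d ≥ 1`, `M` such that `G − M`
is a caterpillar forest, and `c_p = (d³+1)·(2d·|M| + 1)`. Let `C` be a connected
component of `G − M` with (ordered) solution-tight packing enumerated by `Hs`. Then for
each graph `G₁` of the `c_p`-merged packing of `C` there is a graph `G₂` of the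
`(d³+1)`-merged packing of `C` with `G₂ ⊆ G₁` such that every `v ∈ N(G₂) ∩ M` has at
least `d` neighbors in `G₁` left of `G₂` and at least `d` neighbors in `G₁` right of `G₂`. -/
theorem stmt19 {V : Type} [Fintype V] (G : SimpleGraph V) (M : Set V)
    (d : ℕ) (hd : 1 ≤ d)
    (𝔉 : SpinedCatForest G Mᶜ) (c : Fin 𝔉.numComps)
    (t : ℕ) (Hs : Fin t → Set V) (hH : IsOrderedSTP G d (𝔉.comp c) Hs) :
    ∀ i < t / ((d ^ 3 + 1) * (2 * d * M.ncard + 1)),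
      ∃ i₂ < t / (d ^ 3 + 1),
        mergedPiece Hs (d ^ 3 + 1) i₂ ⊆
          mergedPiece Hs ((d ^ 3 + 1) * (2 * d * M.ncard + 1)) i ∧
        ∀ v ∈ M, (∃ a ∈ mergedPiece Hs (d ^ 3 + 1) i₂, G.Adj v a) →
          d ≤ {w : V | w ∈ mergedPiece Hs ((d ^ 3 + 1) * (2 * d * M.ncard + 1)) i ∧
                G.Adj v w ∧ ∀ u ∈ mergedPiece Hs (d ^ 3 + 1) i₂,
                  (𝔉.comp c).pos w < (𝔉.comp c).pos u}.ncard ∧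
          d ≤ {w : V | w ∈ mergedPiece Hs ((d ^ 3 + 1) * (2 * d * M.ncard + 1)) i ∧
                G.Adj v w ∧ ∀ u ∈ mergedPiece Hs (d ^ 3 + 1) i₂,
                  (𝔉.comp c).pos u < (𝔉.comp c).pos w}.ncard := by
  classical
  intro i hi
  set α := d ^ 3 + 1
  set K := 2 * d * M.ncard + 1 with hK
  let p : ℕ → Set V := fun k => mergedPiece Hs α (i * K + k)
  have hpos : ∀ a b, a < b → ∀ v ∈ p a, ∀ w ∈ p b, (𝔉.comp c).pos v < (𝔉.comp c).pos w :=
    fun a b hab v hv w hw => hH.pos_lt_pos (Nat.add_lt_add_left hab _) hv hw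
  have hdisj : ∀ a b, a < b → Disjoint (p a) (p b) := fun a b hab =>
    Set.disjoint_left.2 fun v hv hw => (hpos a b hab v hv v hw).false
  let T : V → Finset ℕ := fun v => (Finset.range K).filter fun k => ∃ a ∈ p k, G.Adj v a
  obtain ⟨k, hk, hgood⟩ := exists_lt_forall_le_card_filter M.toFinset T d
  rw [← Set.ncard_eq_toFinset_card', ← hK] at hk
  refine ⟨i * K + k, ?_, mergedPiece_subset_mergedPiece_mul Hs α hk, fun v hv ha => ?_⟩
  · have hα : 0 < α := Nat.succ_pos _
    have h₁ := (Nat.le_div_iff_mul_le (Nat.mul_pos hα (Nat.succ_pos _))).1 hi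
    refine (Nat.le_div_iff_mul_le hα).2 (le_trans ?_ h₁)
    have h₂ : (k + 1) * α ≤ K * α := Nat.mul_le_mul_right α hk
    rw [Nat.succ_mul, Nat.succ_mul]
    nlinarith
  · obtain ⟨h₁, h₂⟩ := hgood v (Set.mem_toFinset.2 hv)
      (Finset.mem_filter.2 ⟨Finset.mem_range.2 hk, ha⟩)
    refine ⟨h₁.trans (card_le_ncard_of_forall_exists p hdisj fun j hj => ?_),
      h₂.trans (card_le_ncard_of_forall_exists p hdisj fun j hj => ?_)⟩
    all_goals
      obtain ⟨hjT, hjk⟩ := Finset.mem_filter.1 hj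
      obtain ⟨hjK, w, hw, hvw⟩ := Finset.mem_filter.1 hjT
      refine ⟨w, hw, mergedPiece_subset_mergedPiece_mul Hs α (Finset.mem_range.1 hjK) hw, hvw,
        fun u hu => ?_⟩
    · exact hpos j k hjk w hw u hu
    · exact hpos k j hjk u hu w hw

end CocPaper
end
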